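/- arXiv:1712.03833 — 2 statements merged into one kernel-verified Lean document; each statement's English description precedes it below -/
import Mathlib

section
/- The sesquilinear form (·|·) := Σ_{i=1}^{5} (·|·)_i is hermitian and positive definite on C³(cl B⁵;ℂ) × C²(cl B⁵;ℂ), and the norm ‖u‖ := (u|u)^{1/2} it induces is equivalent to the H³(B⁵) × H²(B⁵) norm: there exist c, C > 0 such that c(‖u₁‖²_{H³(B⁵)} + ‖u₂‖²_{H²(B⁵)}) ≤ (u|u) ≤ C(‖u₁‖²_{H³(B⁵)} + ‖u₂‖²_{H²(B⁵)}) for all u = (u₁,u₂) ∈ C³(cl B⁵;ℂ) × C²(cl B⁵;ℂ). -/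
open MeasureTheory ComplexConjugate

noncomputable section

abbrev E5 : Type := EuclideanSpace ℝ (Fin 5)

/-- the partial derivative in the `i`-th coordinate direction -/
def pd (i : Fin 5) (f : E5 → ℂ) : E5 → ℂ :=
  fun x => fderiv ℝ f x (EuclideanSpace.single i 1)

/-- the iterated partial derivative `∂^β` for a multi-index `β` -/
def pdM (β : Fin 5 → ℕ) (f : E5 → ℂ) : E5 → ℂ :=
  (List.finRange 5).foldr (fun i g => (pd i)^[β i] g) f

/-- the Laplacian `Δf = ∑_j ∂_j∂_j f` -/
def lap (f : E5 → ℂ) : E5 → ℂ := fun x => ∑ j : Fin 5, pd j (pd j f) x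

/-- the open unit ball `B⁵ ⊆ ℝ⁵` -/
def ball5 : Set E5 := Metric.ball 0 1

/-- the unit sphere `S⁴ = ∂B⁵` -/
def sph4 : Set E5 := Metric.sphere 0 1

/-- the squared `L²` norm over the unit ball -/
def bL2Sq (f : E5 → ℂ) : ℝ := ∫ x in ball5, ‖f x‖ ^ 2

/-- the squared `H^m(B⁵)` norm: `∑_{|β| ≤ m} ‖∂^β f‖²_{L²(B⁵)}` -/
def HSq (m : ℕ) (f : E5 → ℂ) : ℝ :=
  ∑ β : Fin 5 → Fin (m + 1),
    if (∑ i, (β i : ℕ)) ≤ m then bL2Sq (pdM (fun i => (β i : ℕ)) f) else 0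

/-- the sesquilinear form `(u|v)₁` -/
def ip1 (u v : (E5 → ℂ) × (E5 → ℂ)) : ℂ :=
  (∑ i : Fin 5, ∑ j : Fin 5, ∑ k : Fin 5,
      ∫ x in ball5, pd i (pd j (pd k u.1)) x * conj (pd i (pd j (pd k v.1)) x)) +
    (∑ i : Fin 5, ∑ j : Fin 5,
      ∫ x in ball5, pd i (pd j u.2) x * conj (pd i (pd j v.2) x)) +
    (∑ i : Fin 5, ∑ j : Fin 5,
      ∫ ω in sph4, pd i (pd j u.1) ω * conj (pd i (pd j v.1) ω) ∂μH[4])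

/-- the sesquilinear form `(u|v)₂` -/
def ip2 (u v : (E5 → ℂ) × (E5 → ℂ)) : ℂ :=
  (∑ i : Fin 5, ∫ x in ball5, pd i (lap u.1) x * conj (pd i (lap v.1) x)) +
    (∑ i : Fin 5, ∑ j : Fin 5,
      ∫ x in ball5, pd i (pd j u.2) x * conj (pd i (pd j v.2) x)) +
    (∑ j : Fin 5, ∫ ω in sph4, pd j u.2 ω * conj (pd j v.2 ω) ∂μH[4])

/-- the sesquilinear form `(u|v)₃` -/
def ip3 (u v : (E5 → ℂ) × (E5 → ℂ)) : ℂ :=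
  5 * ip1 u v + ip2 u v + ∫ ω in sph4, u.2 ω * conj (v.2 ω) ∂μH[4]

/-- the sesquilinear form `(u|v)₄` -/
def ip4 (u v : (E5 → ℂ) × (E5 → ℂ)) : ℂ :=
  ip1 u v + ip2 u v + ∑ i : Fin 5, ∫ ω in sph4, pd i u.1 ω * conj (pd i v.1 ω) ∂μH[4]

/-- `ζ(ω, w(ω)) = ω^iω^j ∂_i∂_j w₁(ω) + 5ω^i ∂_i w₁(ω) + 3w₁(ω) + ω^j ∂_j w₂(ω) + 3w₂(ω)` -/
def zeta (w : (E5 → ℂ) × (E5 → ℂ)) (ω : E5) : ℂ :=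
  (∑ i : Fin 5, ∑ j : Fin 5, (ω i : ℂ) * (ω j : ℂ) * pd i (pd j w.1) ω) +
    5 * (∑ i : Fin 5, (ω i : ℂ) * pd i w.1 ω) + 3 * w.1 ω +
    (∑ j : Fin 5, (ω j : ℂ) * pd j w.2 ω) + 3 * w.2 ω

/-- the sesquilinear form `(u|v)₅` -/
def ip5 (u v : (E5 → ℂ) × (E5 → ℂ)) : ℂ :=
  (∫ ω in sph4, zeta u ω ∂μH[4]) * conj (∫ ω in sph4, zeta v ω ∂μH[4])

/-- the full sesquilinear form `(u|v) = ∑_{i=1}^{5} (u|v)_i` -/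
def ipT (u v : (E5 → ℂ) × (E5 → ℂ)) : ℂ :=
  ip1 u v + ip2 u v + ip3 u v + ip4 u v + ip5 u v

section

open Set Metric
open scoped ENNReal NNReal Pointwise

/-- Radial projection onto the unit sphere is Lipschitz outside the unit ball. -/
lemma norm_normalize_sub_normalize_le {x y : E5} (hx : 1 ≤ ‖x‖) (hy : 1 ≤ ‖y‖) :
    ‖‖x‖⁻¹ • x - ‖y‖⁻¹ • y‖ ≤ 2 * ‖x - y‖ := by
  have hx0 : 0 < ‖x‖ := by linarith
  have hy0 : 0 < ‖y‖ := by linarith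
  have h1 : ‖x‖⁻¹ • x - ‖y‖⁻¹ • y = ‖x‖⁻¹ • (x - y) + (‖x‖⁻¹ - ‖y‖⁻¹) • y := by
    rw [smul_sub, sub_smul]; abel
  have hinv : ‖x‖⁻¹ ≤ 1 := inv_le_one_of_one_le₀ hx
  have h2 : ‖‖x‖⁻¹ • (x - y)‖ ≤ ‖x - y‖ := by
    rw [norm_smul, norm_inv, norm_norm]
    exact mul_le_of_le_one_left (norm_nonneg _) hinv
  have h3 : ‖(‖x‖⁻¹ - ‖y‖⁻¹) • y‖ ≤ ‖x - y‖ := by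
    have : (‖x‖⁻¹ - ‖y‖⁻¹) = ‖x‖⁻¹ * ((‖y‖ - ‖x‖) * ‖y‖⁻¹) := by field_simp
    rw [norm_smul, this, norm_mul, norm_mul, norm_inv, norm_inv, norm_norm, norm_norm, mul_assoc,
      mul_assoc, inv_mul_cancel₀ hy0.ne', mul_one]
    refine (mul_le_of_le_one_left (norm_nonneg _) hinv).trans ?_
    rw [norm_sub_rev x y]
    exact abs_norm_sub_norm_le y x
  rw [h1]
  refine (norm_add_le _ _).trans (by linarith)

/-- The affine chart of the hyperplane `{x | x i = s}`. -/
def facePoint (i : Fin 5) (s : ℝ) (y : Fin 4 → ℝ) : E5 :=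
  WithLp.toLp 2 (Fin.insertNth i s y : Fin 5 → ℝ)

lemma norm_sq_facePoint (i : Fin 5) (s : ℝ) (y : Fin 4 → ℝ) :
    ‖facePoint i s y‖ ^ 2 = s ^ 2 + ∑ j, y j ^ 2 := by
  rw [EuclideanSpace.norm_sq_eq, Fin.sum_univ_succAbove _ i]
  simp [facePoint]

lemma facePoint_sub (i : Fin 5) (s : ℝ) (y z : Fin 4 → ℝ) :
    facePoint i s y - facePoint i s z = facePoint i 0 (y - z) := by
  ext k
  rcases Fin.eq_self_or_eq_succAbove i k with rfl | ⟨j, rfl⟩ <;> simp [facePoint]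

lemma norm_facePoint_sub_le (i : Fin 5) (s : ℝ) (y z : Fin 4 → ℝ) :
    ‖facePoint i s y - facePoint i s z‖ ≤ 2 * ‖y - z‖ := by
  rw [facePoint_sub]
  refine abs_le_of_sq_le_sq' ?_ (by positivity) |>.2
  rw [norm_sq_facePoint]
  have : ∀ j, (y - z) j ^ 2 ≤ ‖y - z‖ ^ 2 := fun j => by
    rw [← sq_abs]
    exact pow_le_pow_left₀ (abs_nonneg _) (norm_le_pi_norm (y - z) j) 2
  have h := Finset.sum_le_sum (s := Finset.univ) fun j _ => this j
  simp only [Finset.sum_const, Finset.card_univ, Fintype.card_fin, nsmul_eq_mul] at h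
  push_cast at h
  nlinarith

lemma one_le_norm_facePoint (i : Fin 5) {s : ℝ} (hs : s ^ 2 = 1) (y : Fin 4 → ℝ) :
    1 ≤ ‖facePoint i s y‖ := by
  have h := norm_sq_facePoint i s y
  have : 0 ≤ ∑ j, y j ^ 2 := Finset.sum_nonneg fun j _ => sq_nonneg _
  nlinarith [norm_nonneg (facePoint i s y)]

lemma norm_facePoint_le (i : Fin 5) {s : ℝ} (hs : s ^ 2 = 1) {y : Fin 4 → ℝ}
    (hy : ∀ j, |y j| ≤ 1) : ‖facePoint i s y‖ < 3 := by
  have h := norm_sq_facePoint i s y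
  have : ∑ j, y j ^ 2 ≤ ∑ _j : Fin 4, (1 : ℝ) :=
    Finset.sum_le_sum fun j _ => (sq_le_one_iff_abs_le_one _).2 (hy j)
  simp only [Finset.sum_const, Finset.card_univ, Fintype.card_fin, nsmul_eq_mul] at this
  push_cast at this
  nlinarith [norm_nonneg (facePoint i s y)]

/-- Central projection of a face of the cube `[-1,1]⁵` to the unit sphere. -/
def faceProj (i : Fin 5) (s : ℝ) (y : Fin 4 → ℝ) : E5 :=
  ‖facePoint i s y‖⁻¹ • facePoint i s y

lemma lipschitzWith_faceProj (i : Fin 5) {s : ℝ} (hs : s ^ 2 = 1) :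
    LipschitzWith 4 (faceProj i s) := by
  refine LipschitzWith.of_dist_le_mul fun y z => ?_
  rw [dist_eq_norm, dist_eq_norm]
  refine (norm_normalize_sub_normalize_le (one_le_norm_facePoint i hs y)
    (one_le_norm_facePoint i hs z)).trans ?_
  have := norm_facePoint_sub_le i s y z
  push_cast
  linarith

/-- The part of `[-1,1]⁴` which is projected to `T` from a face of the cube. -/
def facePre (i : Fin 5) (s : ℝ) (T : Set E5) : Set (Fin 4 → ℝ) :=
  {y | (∀ j, |y j| ≤ 1) ∧ faceProj i s y ∈ T}

lemma hausdorffMeasure_image_facePre_le (i : Fin 5) {s : ℝ} (hs : s ^ 2 = 1) (T : Set E5) :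
    μH[4] (faceProj i s '' facePre i s T) ≤ 4 ^ 4 * volume (facePre i s T) := by
  have h := (lipschitzWith_faceProj i hs).hausdorffMeasure_image_le (d := 4) (by norm_num)
    (facePre i s T)
  have h4 : (μH[4] : Measure (Fin 4 → ℝ)) = volume := by
    simpa using hausdorffMeasure_pi_real (ι := Fin 4)
  rw [h4] at h
  refine h.trans (le_of_eq ?_)
  norm_num

/-- Every point of the unit sphere is the projection of a point in some face. -/
lemma subset_iUnion_image_facePre {T : Set E5} (hT : T ⊆ sph4) :
    T ⊆ ⋃ i : Fin 5, (faceProj i 1 '' facePre i 1 T ∪ faceProj i (-1) '' facePre i (-1) T) := by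
  intro ω hω
  have hω1 : ‖ω‖ = 1 := by simpa [sph4] using hT hω
  obtain ⟨i, -, hi⟩ := Finset.exists_max_image Finset.univ (fun i => |ω i|) ⟨0, Finset.mem_univ _⟩
  have hpos : 0 < |ω i| := by
    by_contra hcon
    have : ω = 0 := by
      ext j
      have := hi j (Finset.mem_univ _)
      have h0 : |ω j| = 0 := le_antisymm (by linarith [abs_nonneg (ω i)]) (abs_nonneg _)
      simpa using h0
    simp [this] at hω1
  obtain ⟨s, hs, hsi⟩ : ∃ s : ℝ, (s = 1 ∨ s = -1) ∧ |ω i| * s = ω i := by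
    rcases le_total 0 (ω i) with h | h
    · exact ⟨1, .inl rfl, by rw [abs_of_nonneg h, mul_one]⟩
    · exact ⟨-1, .inr rfl, by rw [abs_of_nonpos h]; ring⟩
  let y : Fin 4 → ℝ := fun j => |ω i|⁻¹ * ω (i.succAbove j)
  have hy : facePoint i s y = |ω i|⁻¹ • ω := by
    ext k
    rcases Fin.eq_self_or_eq_succAbove i k with rfl | ⟨j, rfl⟩
    · simp [facePoint]
      field_simp
      linarith
    · simp [facePoint, y]
  have hproj : faceProj i s y = ω := by
    rw [faceProj, hy, norm_smul, hω1, mul_one, norm_inv, norm_abs_eq_norm, Real.norm_eq_abs,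
      inv_inv, smul_smul, mul_inv_cancel₀ hpos.ne', one_smul]
  have hmem : ω ∈ faceProj i s '' facePre i s T := by
    refine ⟨y, ⟨fun j => ?_, by rwa [hproj]⟩, hproj⟩
    rw [abs_mul, abs_inv, abs_abs, inv_mul_le_iff₀ hpos, mul_one]
    exact hi _ (Finset.mem_univ _)
  rw [mem_iUnion]
  refine ⟨i, ?_⟩
  rcases hs with rfl | rfl
  · exact .inl hmem
  · exact .inr hmem

lemma lintegral_section_le_prod (s : Set (ℝ × (Fin 4 → ℝ))) :
    ∫⁻ τ, volume (Prod.mk τ ⁻¹' s) ≤ (volume.prod volume) s := by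
  rw [← measure_toMeasurable s, Measure.prod_apply (measurableSet_toMeasurable _ _)]
  gcongr
  exact subset_toMeasurable _ _

/-- The volume of the part of a face that projects to `T` is controlled by the volume of the
cone over `T`. -/
lemma volume_facePre_le (i : Fin 5) {s : ℝ} (hs : s = 1 ∨ s = -1) (T : Set E5) :
    volume (facePre i s T) ≤ 6 ^ 5 * volume (Ioo (0 : ℝ) 1 • T) := by
  have hs2 : s ^ 2 = 1 := by rcases hs with rfl | rfl <;> norm_num
  set P := facePre i s T
  let J : Set ℝ := {τ | s * τ ∈ Ioo (1 / 6 : ℝ) (1 / 3)}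
  have hJ : volume J = ENNReal.ofReal (1 / 6) := by
    rcases hs with rfl | rfl
    · have : J = Ioo (1 / 6 : ℝ) (1 / 3) := by ext; simp [J]
      rw [this, Real.volume_Ioo]; norm_num
    · have : J = Ioo (-(1 / 3) : ℝ) (-(1 / 6)) := by
        ext τ
        simp only [J, mem_ofPred_eq, mem_Ioo]
        constructor <;> rintro ⟨h1, h2⟩ <;> constructor <;> linarith
      rw [this, Real.volume_Ioo]; norm_num
  have hJm : MeasurableSet J := by
    have : Measurable fun τ : ℝ => s * τ := by fun_prop
    exact this measurableSet_Ioo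
  let ee : E5 ≃ᵐ ℝ × (Fin 4 → ℝ) :=
    (MeasurableEquiv.toLp 2 (Fin 5 → ℝ)).symm.trans (MeasurableEquiv.piFinSuccAbove (fun _ => ℝ) i)
  have hee : MeasurePreserving ee volume volume :=
    (volume_preserving_piFinSuccAbove (fun _ : Fin 5 => ℝ) i).comp
      (PiLp.volume_preserving_ofLp (Fin 5))
  have hsec : ∀ τ ∈ J, ENNReal.ofReal ((1 / 6) ^ 4) * volume P ≤
      volume (Prod.mk τ ⁻¹' (ee '' (Ioo (0 : ℝ) 1 • T))) := by
    intro τ hτ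
    have hτ' : s * τ ∈ Ioo (1 / 6 : ℝ) (1 / 3) := hτ
    have hsub : (s * τ) • P ⊆ Prod.mk τ ⁻¹' (ee '' (Ioo (0 : ℝ) 1 • T)) := by
      rintro _ ⟨y, hy, rfl⟩
      refine ⟨(s * τ) • facePoint i s y, ?_, ?_⟩
      · have h1 := one_le_norm_facePoint i hs2 y
        have h3 := norm_facePoint_le i hs2 hy.1
        refine ⟨s * τ * ‖facePoint i s y‖, ⟨by have := hτ'.1; positivity, ?_⟩, _, hy.2, ?_⟩
        · have := hτ'.1; have := hτ'.2
          nlinarith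
        · simp only [faceProj]
          rw [smul_smul, mul_assoc, mul_inv_cancel₀ (by linarith), mul_one]
      · have hss : s * τ * s = τ := by linear_combination τ * hs2
        apply Prod.ext
        · change ((s * τ) • facePoint i s y) i = τ
          simpa [facePoint] using hss
        · ext j
          change ((s * τ) • facePoint i s y) (i.succAbove j) = _
          simp [facePoint]
    refine le_trans ?_ (measure_mono hsub)
    rw [Measure.addHaar_smul]
    gcongr
    simp only [Module.finrank_fintype_fun_eq_card, Fintype.card_fin]
    have := hτ'.1
    rw [abs_of_pos (by positivity)]
    gcongr
  have hkey : ENNReal.ofReal ((1 / 6) ^ 4) * volume P * ENNReal.ofReal (1 / 6) ≤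
      volume (Ioo (0 : ℝ) 1 • T) := by
    calc _ = ∫⁻ _ in J, ENNReal.ofReal ((1 / 6) ^ 4) * volume P := by
          rw [setLIntegral_const, hJ]
      _ ≤ ∫⁻ τ in J, volume (Prod.mk τ ⁻¹' (ee '' (Ioo (0 : ℝ) 1 • T))) :=
          setLIntegral_mono' hJm hsec
      _ ≤ ∫⁻ τ, volume (Prod.mk τ ⁻¹' (ee '' (Ioo (0 : ℝ) 1 • T))) := setLIntegral_le_lintegral _ _
      _ ≤ (volume.prod volume) (ee '' (Ioo (0 : ℝ) 1 • T)) := lintegral_section_le_prod _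
      _ = volume (Ioo (0 : ℝ) 1 • T) := by
          rw [← Measure.volume_eq_prod, ← hee.measure_preimage_equiv,
            preimage_image_eq _ ee.injective]
  calc volume P = 6 ^ 5 * (ENNReal.ofReal ((1 / 6) ^ 4) * volume P * ENNReal.ofReal (1 / 6)) := by
        have : (6 : ℝ≥0∞) ^ 5 = ENNReal.ofReal (6 ^ 5) := by
          rw [ENNReal.ofReal_pow (by norm_num)]; norm_num
        rw [this, mul_right_comm, ← ENNReal.ofReal_mul (by positivity), ← mul_assoc,
          ← ENNReal.ofReal_mul (by positivity)]
        norm_num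
    _ ≤ _ := by gcongr

/-- On the unit sphere, the Hausdorff measure is bounded by a multiple of the cone volume. -/
lemma hausdorffMeasure_le_volume_cone {T : Set E5} (hT : T ⊆ sph4) :
    μH[4] T ≤ (10 * 4 ^ 4 * 6 ^ 5) * volume (Ioo (0 : ℝ) 1 • T) := by
  have hface : ∀ i : Fin 5, ∀ s : ℝ, (s = 1 ∨ s = -1) →
      μH[4] (faceProj i s '' facePre i s T) ≤ 4 ^ 4 * 6 ^ 5 * volume (Ioo (0 : ℝ) 1 • T) := by
    intro i s hs
    have hs2 : s ^ 2 = 1 := by rcases hs with rfl | rfl <;> norm_num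
    refine (hausdorffMeasure_image_facePre_le i hs2 T).trans ?_
    rw [mul_assoc]
    gcongr
    exact volume_facePre_le i hs T
  calc μH[4] T ≤ μH[4] (⋃ i : Fin 5,
        (faceProj i 1 '' facePre i 1 T ∪ faceProj i (-1) '' facePre i (-1) T)) :=
        measure_mono (subset_iUnion_image_facePre hT)
    _ ≤ ∑ i : Fin 5,
        μH[4] (faceProj i 1 '' facePre i 1 T ∪ faceProj i (-1) '' facePre i (-1) T) :=
        measure_iUnion_fintype_le _ _
    _ ≤ ∑ _i : Fin 5, (4 ^ 4 * 6 ^ 5 * volume (Ioo (0 : ℝ) 1 • T) +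
          4 ^ 4 * 6 ^ 5 * volume (Ioo (0 : ℝ) 1 • T)) := by
        refine Finset.sum_le_sum fun i _ => (measure_union_le _ _).trans ?_
        exact add_le_add (hface i 1 (.inl rfl)) (hface i (-1) (.inr rfl))
    _ = _ := by
        simp only [Finset.sum_const, Finset.card_univ, Fintype.card_fin, nsmul_eq_mul]
        push_cast
        ring

/-- The surface measure on the unit sphere. -/
abbrev surf : Measure E5 := (μH[4] : Measure E5).restrict sph4

lemma measurableSet_sph4 : MeasurableSet sph4 := isClosed_sphere.measurableSet

lemma surf_le_toSphere :
    surf ≤ (10 * 4 ^ 4 * 6 ^ 5 : ℝ≥0∞) •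
      ((volume : Measure E5).toSphere.map (Subtype.val : sphere (0 : E5) 1 → E5)) := by
  refine Measure.le_iff.2 fun A hA => ?_
  rw [Measure.restrict_apply hA, Measure.smul_apply, Measure.map_apply measurable_subtype_coe hA,
    Measure.toSphere_apply' _ (measurable_subtype_coe hA), smul_eq_mul,
    Subtype.image_preimage_coe, inter_comm (sphere (0 : E5) 1)]
  refine (hausdorffMeasure_le_volume_cone inter_subset_right).trans ?_
  gcongr
  change _ ≤ _ * volume (Ioo (0 : ℝ) 1 • (A ∩ sph4))
  refine le_mul_of_one_le_left' ?_
  simp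

instance isFiniteMeasure_surf : IsFiniteMeasure surf := by
  refine ⟨(surf_le_toSphere univ).trans_lt ?_⟩
  rw [Measure.smul_apply, smul_eq_mul]
  exact ENNReal.mul_lt_top (by norm_num [ENNReal.mul_lt_top_iff]) (measure_lt_top _ _)

lemma surf_univ_pos : 0 < surf univ := by
  rw [Measure.restrict_apply_univ]
  let p : E5 → (Fin 4 → ℝ) := fun x j => x (Fin.succ j)
  have hp : LipschitzWith 1 p := by
    refine LipschitzWith.of_dist_le_mul fun x y => ?_
    rw [NNReal.coe_one, one_mul, dist_eq_norm, dist_eq_norm]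
    refine (pi_norm_le_iff_of_nonneg (norm_nonneg _)).2 fun j => ?_
    exact PiLp.norm_apply_le (x - y) (Fin.succ j)
  have h := hp.hausdorffMeasure_image_le (d := 4) (by norm_num) sph4
  have h4 : (μH[4] : Measure (Fin 4 → ℝ)) = volume := by
    simpa using hausdorffMeasure_pi_real (ι := Fin 4)
  rw [h4] at h
  have hsub : ball (0 : Fin 4 → ℝ) (1 / 2) ⊆ p '' sph4 := by
    intro y hy
    have hy' : ∀ j, |y j| ≤ 1 / 2 := fun j =>
      (norm_le_pi_norm y j).trans (by simpa using (mem_ball_zero_iff.1 hy).le)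
    have hsum : ∑ j, y j ^ 2 ≤ 1 := by
      have : ∑ j, y j ^ 2 ≤ ∑ _j : Fin 4, (1 / 4 : ℝ) := Finset.sum_le_sum fun j _ => by
        have := abs_le.1 (hy' j); nlinarith
      refine this.trans ?_
      norm_num
    refine ⟨facePoint 0 (Real.sqrt (1 - ∑ j, y j ^ 2)) y, ?_, ?_⟩
    · have := norm_sq_facePoint 0 (Real.sqrt (1 - ∑ j, y j ^ 2)) y
      rw [Real.sq_sqrt (by linarith), sub_add_cancel] at this
      simpa [sph4] using (pow_eq_one_iff_of_nonneg (norm_nonneg _) two_ne_zero).1 this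
    · ext j
      simp [p, facePoint]
  have hpos : 0 < volume (ball (0 : Fin 4 → ℝ) (1 / 2)) := measure_ball_pos _ _ (by norm_num)
  have := hpos.trans_le ((measure_mono hsub).trans h)
  simpa using this

lemma measurableSet_ball5 : MeasurableSet ball5 := isOpen_ball.measurableSet

instance isFiniteMeasure_ball5 : IsFiniteMeasure ((volume : Measure E5).restrict ball5) :=
  ⟨by rw [Measure.restrict_apply_univ]; exact measure_ball_lt_top⟩

lemma volume_ball5_pos : 0 < (volume : Measure E5).real ball5 :=
  ENNReal.toReal_pos (measure_ball_pos _ _ one_pos).ne' measure_ball_lt_top.ne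

lemma surf_real_univ_pos : 0 < surf.real univ :=
  ENNReal.toReal_pos surf_univ_pos.ne' (measure_ne_top _ _)

lemma Continuous.integrable_ball5 {F : Type*} [NormedAddCommGroup F] {g : E5 → F}
    (hg : Continuous g) : Integrable g (volume.restrict ball5) :=
  (hg.continuousOn.integrableOn_compact (isCompact_closedBall (0 : E5) 1)).mono_set
    ball_subset_closedBall

lemma Continuous.integrable_surf {F : Type*} [NormedAddCommGroup F] {g : E5 → F}
    (hg : Continuous g) : Integrable g surf := by
  obtain ⟨C, hC⟩ := (isCompact_sphere (0 : E5) 1).exists_bound_of_continuousOn hg.continuousOn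
  refine Integrable.of_bound hg.aestronglyMeasurable C ?_
  filter_upwards [ae_restrict_mem measurableSet_sph4] with x hx using hC x hx

/-- The Cauchy–Schwarz inequality against a constant. -/
lemma sq_norm_integral_le {α F : Type*} [MeasurableSpace α] {μ : Measure α} [IsFiniteMeasure μ]
    [NormedAddCommGroup F] [NormedSpace ℝ F] {f : α → F} (hf : Integrable f μ)
    (hf2 : Integrable (fun x => ‖f x‖ ^ 2) μ) :
    ‖∫ x, f x ∂μ‖ ^ 2 ≤ μ.real univ * ∫ x, ‖f x‖ ^ 2 ∂μ := by
  set M := μ.real univ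
  set A := ∫ x, ‖f x‖ ∂μ
  have hA : ‖∫ x, f x ∂μ‖ ≤ A := norm_integral_le_integral_norm f
  have hA2 : ‖∫ x, f x ∂μ‖ ^ 2 ≤ A ^ 2 := pow_le_pow_left₀ (norm_nonneg _) hA 2
  refine hA2.trans ?_
  have hM0 : 0 ≤ M := measureReal_nonneg
  rcases hM0.eq_or_lt with hM | hM
  · have h0 : μ = 0 := by
      rw [← Measure.measure_univ_eq_zero]
      exact ((ENNReal.toReal_eq_zero_iff _).1 hM.symm).resolve_right (measure_ne_top _ _)
    simp [A, h0]
  have h : 0 ≤ ∫ x, (M * ‖f x‖ - A) ^ 2 ∂μ := integral_nonneg fun x => sq_nonneg _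
  have h' : ∫ x, (M * ‖f x‖ - A) ^ 2 ∂μ =
      M ^ 2 * ∫ x, ‖f x‖ ^ 2 ∂μ - 2 * M * A * A + M * A ^ 2 := by
    have : ∀ x, (M * ‖f x‖ - A) ^ 2 = M ^ 2 * ‖f x‖ ^ 2 - 2 * M * A * ‖f x‖ + A ^ 2 := fun x => by
      ring
    simp_rw [this]
    have hi : Integrable (fun x => M ^ 2 * ‖f x‖ ^ 2 - 2 * M * A * ‖f x‖) μ :=
      (hf2.const_mul _).sub (hf.norm.const_mul _)
    rw [integral_add hi (integrable_const _),
      integral_sub (hf2.const_mul _) (hf.norm.const_mul _), integral_const_mul, integral_const_mul,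
      integral_const, smul_eq_mul]
  rw [h'] at h
  have : 0 ≤ M * (M * ∫ x, ‖f x‖ ^ 2 ∂μ - A ^ 2) := by linarith
  have := nonneg_of_mul_nonneg_right this hM
  linarith

/-- Integration over the unit ball in polar coordinates. -/
lemma lintegral_polar_le {H : E5 → ℝ≥0∞} (hH : Measurable H) :
    ∫⁻ ω : sphere (0 : E5) 1, (∫⁻ t in Ioo (0 : ℝ) 1, ENNReal.ofReal (t ^ 4) * H (t • (ω : E5)))
      ∂(volume : Measure E5).toSphere ≤ ∫⁻ x in ball5, H x := by
  have hG : Measurable (ball5.indicator H) := hH.indicator measurableSet_ball5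
  have hmp := (volume : Measure E5).measurePreserving_homeomorphUnitSphereProd
  have hdim : Module.finrank ℝ E5 - 1 = 4 := by simp
  rw [hdim] at hmp
  have h1 : ∫⁻ x in ball5, H x = ∫⁻ x in ({0}ᶜ : Set E5), ball5.indicator H x := by
    rw [← lintegral_indicator measurableSet_ball5, restrict_compl_singleton]
  rw [h1, ← lintegral_subtype_comap (measurableSet_singleton _).compl]
  have h2 : ∀ x : ({0}ᶜ : Set E5), ball5.indicator H x =
      (fun p : sphere (0 : E5) 1 × Ioi (0 : ℝ) => ball5.indicator H ((p.2 : ℝ) • (p.1 : E5)))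
        (homeomorphUnitSphereProd E5 x) := fun x => by
    have := homeomorphUnitSphereProd_symm_apply_coe E5 (homeomorphUnitSphereProd E5 x)
    rw [Homeomorph.symm_apply_apply] at this
    simp only [← this]
  have hm : Measurable (fun p : sphere (0 : E5) 1 × Ioi (0 : ℝ) =>
      ball5.indicator H ((p.2 : ℝ) • (p.1 : E5))) := hG.comp (by fun_prop)
  simp_rw [h2]
  rw [hmp.lintegral_comp hm, lintegral_prod _ hm.aemeasurable]
  refine lintegral_mono fun ω => ?_
  have hω : ‖(ω : E5)‖ = 1 := by simp
  have hmω : Measurable fun y : Ioi (0 : ℝ) => ball5.indicator H ((y : ℝ) • (ω : E5)) :=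
    hG.comp (by fun_prop)
  rw [Measure.volumeIoiPow, lintegral_withDensity_eq_lintegral_mul _ (by fun_prop) hmω]
  simp only [Pi.mul_apply]
  rw [lintegral_subtype_comap measurableSet_Ioi
    (fun r : ℝ => ENNReal.ofReal (r ^ 4) * ball5.indicator H (r • (ω : E5)))]
  refine le_trans ?_ (lintegral_mono_set (Ioo_subset_Ioi_self (b := (0 : ℝ)) (a := (1 : ℝ))))
  refine setLIntegral_mono' measurableSet_Ioo fun t ht => ?_
  rw [indicator_of_mem]
  simpa [ball5, norm_smul, hω, abs_of_pos ht.1] using ht.2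

/-- Pointwise trace estimate along a ray. -/
lemma sq_norm_le_integral_ray {f : E5 → ℂ} (hf : ContDiff ℝ 1 f) {ω : E5} (hω : ‖ω‖ = 1) :
    ‖f ω‖ ^ 2 ≤ ∫ t in (0 : ℝ)..1, t ^ 4 * (6 * (‖f (t • ω)‖ ^ 2 + ‖fderiv ℝ f (t • ω)‖ ^ 2)) := by
  have hfc : Continuous f := hf.continuous
  have hdc : Continuous (fderiv ℝ f) := hf.continuous_fderiv one_ne_zero
  have hd : ∀ t : ℝ, HasDerivAt (fun t : ℝ => f (t • ω)) (fderiv ℝ f (t • ω) ω) t := fun t => by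
    have h := (hf.differentiable one_ne_zero (t • ω)).hasFDerivAt.comp_hasDerivAt t
      ((hasDerivAt_id t).smul_const ω)
    rw [one_smul] at h
    exact h
  have hg : ∀ t : ℝ, HasDerivAt (fun t : ℝ => t ^ 5 * ‖f (t • ω)‖ ^ 2)
      (5 * t ^ 4 * ‖f (t • ω)‖ ^ 2 +
        t ^ 5 * (2 * inner ℝ (f (t • ω)) (fderiv ℝ f (t • ω) ω))) t := fun t => by
    have h := (hasDerivAt_pow 5 t).mul (hd t).norm_sq
    norm_num at h ⊢
    exact h
  have hcont : Continuous fun t : ℝ => 5 * t ^ 4 * ‖f (t • ω)‖ ^ 2 +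
        t ^ 5 * (2 * inner ℝ (f (t • ω)) (fderiv ℝ f (t • ω) ω)) := by fun_prop
  have hint := intervalIntegral.integral_eq_sub_of_hasDerivAt (a := 0) (b := 1)
    (fun t _ => hg t) (hcont.intervalIntegrable _ _)
  have hcont2 : Continuous fun t : ℝ =>
      t ^ 4 * (6 * (‖f (t • ω)‖ ^ 2 + ‖fderiv ℝ f (t • ω)‖ ^ 2)) := by fun_prop
  have : ‖f ω‖ ^ 2 = ∫ t in (0 : ℝ)..1, (5 * t ^ 4 * ‖f (t • ω)‖ ^ 2 +
        t ^ 5 * (2 * inner ℝ (f (t • ω)) (fderiv ℝ f (t • ω) ω))) := by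
    rw [hint]; simp
  rw [this]
  refine intervalIntegral.integral_mono_on zero_le_one (hcont.intervalIntegrable _ _)
    (hcont2.intervalIntegrable _ _) fun t ht => ?_
  have h1 : inner ℝ (f (t • ω)) (fderiv ℝ f (t • ω) ω) ≤ ‖f (t • ω)‖ * ‖fderiv ℝ f (t • ω)‖ := by
    refine (real_inner_le_norm _ _).trans ?_
    gcongr
    simpa [hω] using (fderiv ℝ f (t • ω)).le_opNorm ω
  set a := ‖f (t • ω)‖
  set b := ‖fderiv ℝ f (t • ω)‖
  have h2 : t * (2 * inner ℝ (f (t • ω)) (fderiv ℝ f (t • ω) ω)) ≤ a ^ 2 + b ^ 2 := by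
    have h3 : 2 * (a * b) ≤ a ^ 2 + b ^ 2 := by nlinarith [sq_nonneg (a - b)]
    have h4 : t * (2 * inner ℝ (f (t • ω)) (fderiv ℝ f (t • ω) ω)) ≤ t * (a ^ 2 + b ^ 2) :=
      mul_le_mul_of_nonneg_left (by linarith) ht.1
    have h5 : t * (a ^ 2 + b ^ 2) ≤ a ^ 2 + b ^ 2 :=
      mul_le_of_le_one_left (by positivity) ht.2
    linarith
  have h6 := mul_le_mul_of_nonneg_left h2 (pow_nonneg ht.1 4)
  have h7 : 0 ≤ t ^ 4 * b ^ 2 := mul_nonneg (pow_nonneg ht.1 4) (sq_nonneg _)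
  nlinarith

/-- The squared `L²` norm of the gradient over the unit ball. -/
def gradSq (f : E5 → ℂ) : ℝ := ∫ x in ball5, ‖fderiv ℝ f x‖ ^ 2

/-- The trace inequality on the unit ball. -/
lemma exists_trace_const : ∃ C : ℝ, 0 < C ∧ ∀ f : E5 → ℂ, ContDiff ℝ 1 f →
    ∫ ω, ‖f ω‖ ^ 2 ∂surf ≤ C * (bL2Sq f + gradSq f) := by
  refine ⟨10 * 4 ^ 4 * 6 ^ 5 * 6, by norm_num, fun f hf => ?_⟩
  have hfc : Continuous f := hf.continuous
  have hdc : Continuous (fderiv ℝ f) := hf.continuous_fderiv one_ne_zero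
  let h : E5 → ℝ := fun x => 6 * (‖f x‖ ^ 2 + ‖fderiv ℝ f x‖ ^ 2)
  have hh : Continuous h := by fun_prop
  have hh0 : ∀ x, 0 ≤ h x := fun x => by positivity
  have hray : ∀ ω : sphere (0 : E5) 1, ENNReal.ofReal (‖f ω‖ ^ 2) ≤
      ∫⁻ t in Ioo (0 : ℝ) 1, ENNReal.ofReal (t ^ 4) * ENNReal.ofReal (h (t • (ω : E5))) := by
    intro ω
    have hω : ‖(ω : E5)‖ = 1 := by simp
    refine (ENNReal.ofReal_le_ofReal (sq_norm_le_integral_ray hf hω)).trans ?_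
    rw [intervalIntegral.integral_of_le zero_le_one, ← Measure.restrict_congr_set Ioo_ae_eq_Ioc,
      ofReal_integral_eq_lintegral_ofReal]
    · refine lintegral_mono fun t => ?_
      rw [ENNReal.ofReal_mul (by positivity)]
    · have : Continuous fun t : ℝ => t ^ 4 * h (t • (ω : E5)) := by fun_prop
      exact (this.continuousOn.integrableOn_compact
        (isCompact_Icc (a := (0 : ℝ)) (b := 1))).mono_set Ioo_subset_Icc_self
    · exact Filter.Eventually.of_forall fun t => mul_nonneg (by positivity) (hh0 _)
  have hm : Measurable fun x => ENNReal.ofReal (‖f x‖ ^ 2) := by fun_prop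
  have key : ∫⁻ ω, ENNReal.ofReal (‖f ω‖ ^ 2) ∂surf ≤
      (10 * 4 ^ 4 * 6 ^ 5 : ℝ≥0∞) * ∫⁻ x in ball5, ENNReal.ofReal (h x) := by
    refine (lintegral_mono' surf_le_toSphere le_rfl).trans ?_
    rw [lintegral_smul_measure, lintegral_map hm measurable_subtype_coe, smul_eq_mul]
    gcongr
    exact (lintegral_mono hray).trans
      (lintegral_polar_le (H := fun x => ENNReal.ofReal (h x)) (by fun_prop))
  rw [← ofReal_integral_eq_lintegral_ofReal (Continuous.integrable_surf (by fun_prop))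
    (Filter.Eventually.of_forall fun x => by positivity),
    ← ofReal_integral_eq_lintegral_ofReal hh.integrable_ball5
    (Filter.Eventually.of_forall hh0)] at key
  have hc : (10 * 4 ^ 4 * 6 ^ 5 : ℝ≥0∞) = ENNReal.ofReal (10 * 4 ^ 4 * 6 ^ 5) := by
    norm_num
  rw [hc, ← ENNReal.ofReal_mul (by norm_num), ENNReal.ofReal_le_ofReal_iff
    (mul_nonneg (by norm_num) (integral_nonneg hh0))] at key
  refine key.trans (le_of_eq ?_)
  have : ∫ x in ball5, h x = 6 * (bL2Sq f + gradSq f) := by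
    simp only [h, bL2Sq, gradSq]
    rw [integral_const_mul, integral_add (Continuous.integrable_ball5 (by fun_prop))
      (Continuous.integrable_ball5 (by fun_prop))]
  rw [this]; ring

/-- Contracting the unit ball towards one of its points by a factor of at least `1/2` costs a factor
of at most `2⁵` in integrals. -/
lemma lintegral_contract_le {N : E5 → ℝ≥0∞} (hN : Measurable N) {y : E5} (hy : y ∈ ball5) {t : ℝ}
    (ht : t ∈ Ioc (0 : ℝ) (1 / 2)) :
    ∫⁻ x in ball5, N ((1 - t) • x + t • y) ≤ 32 * ∫⁻ x in ball5, N x := by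
  have ht1 : (1 / 2 : ℝ) ≤ 1 - t := by linarith [ht.2]
  have hG : Measurable (ball5.indicator N) := hN.indicator measurableSet_ball5
  have hconv : Convex ℝ ball5 := convex_ball _ _
  calc ∫⁻ x in ball5, N ((1 - t) • x + t • y)
      = ∫⁻ x in ball5, ball5.indicator N ((1 - t) • x + t • y) := by
        refine setLIntegral_congr_fun measurableSet_ball5 fun x hx => ?_
        rw [indicator_of_mem (hconv hx hy (by linarith) ht.1.le (by ring))]
    _ ≤ ∫⁻ x, ball5.indicator N ((1 - t) • x + t • y) := setLIntegral_le_lintegral _ _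
    _ = ∫⁻ z, ball5.indicator N (z + t • y) ∂(volume.map fun x : E5 => (1 - t) • x) := by
        have hGy : Measurable fun z => ball5.indicator N (z + t • y) := hG.comp (by fun_prop)
        rw [lintegral_map hGy (by fun_prop)]
    _ = ENNReal.ofReal |((1 - t) ^ 5)⁻¹| * ∫⁻ x in ball5, N x := by
        rw [Measure.map_addHaar_smul _ (by linarith), lintegral_smul_measure,
          lintegral_add_right_eq_self (ball5.indicator N), lintegral_indicator measurableSet_ball5]
        simp
    _ ≤ _ := by
        gcongr
        rw [abs_of_nonneg (by positivity)]
        have h32 : (32 : ℝ≥0∞) = ENNReal.ofReal 32 := by norm_num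
        rw [h32]
        refine ENNReal.ofReal_le_ofReal ?_
        rw [inv_le_comm₀ (by positivity) (by norm_num)]
        calc (32 : ℝ)⁻¹ = (1 / 2) ^ 5 := by norm_num
          _ ≤ _ := by gcongr

lemma sq_norm_sub_midpoint_le {f : E5 → ℂ} (hf : ContDiff ℝ 1 f) {x y : E5} (hx : x ∈ ball5)
    (hy : y ∈ ball5) :
    ‖f x - f ((1 / 2 : ℝ) • x + (1 / 2 : ℝ) • y)‖ ^ 2 ≤
      2 * ∫ t in Ioc (0 : ℝ) (1 / 2), ‖fderiv ℝ f ((1 - t) • x + t • y)‖ ^ 2 := by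
  have hdc : Continuous (fderiv ℝ f) := hf.continuous_fderiv one_ne_zero
  have hd : ∀ t : ℝ, HasDerivAt (fun t : ℝ => f ((1 - t) • x + t • y))
      (fderiv ℝ f ((1 - t) • x + t • y) (y - x)) t := fun t => by
    have h0 : HasDerivAt (fun t : ℝ => (1 - t) • x + t • y) (y - x) t := by
      have h := (((hasDerivAt_id t).const_sub 1).smul_const x).add
        ((hasDerivAt_id t).smul_const y)
      rw [one_smul, neg_one_smul, neg_add_eq_sub] at h
      exact h
    exact (hf.differentiable one_ne_zero ((1 - t) • x + t • y)).hasFDerivAt.comp_hasDerivAt t h0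
  have hc : Continuous fun t : ℝ => fderiv ℝ f ((1 - t) • x + t • y) (y - x) := by fun_prop
  have hcI : ∀ {g : ℝ → ℝ}, Continuous g → IntegrableOn g (Ioc 0 (1 / 2)) := fun hg =>
    (hg.continuousOn.integrableOn_compact (isCompact_Icc (a := (0 : ℝ)) (b := 1 / 2))).mono_set
      Ioc_subset_Icc_self
  have hint := intervalIntegral.integral_eq_sub_of_hasDerivAt (a := 0) (b := 1 / 2)
    (fun t _ => hd t) (hc.intervalIntegrable _ _)
  rw [intervalIntegral.integral_of_le (by norm_num)] at hint
  have h12 : (1 - 1 / 2 : ℝ) = 1 / 2 := by norm_num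
  rw [sub_zero, one_smul, zero_smul, add_zero, h12] at hint
  rw [norm_sub_rev, ← hint]
  refine (sq_norm_integral_le (hc.integrableOn_Ioc) (hcI (by fun_prop))).trans ?_
  have hv : (volume.restrict (Ioc (0 : ℝ) (1 / 2))).real univ = 1 / 2 := by
    simp
  rw [hv]
  have hle : ∫ t in Ioc (0 : ℝ) (1 / 2), ‖fderiv ℝ f ((1 - t) • x + t • y) (y - x)‖ ^ 2 ≤
      ∫ t in Ioc (0 : ℝ) (1 / 2), 4 * ‖fderiv ℝ f ((1 - t) • x + t • y)‖ ^ 2 := by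
    refine setIntegral_mono (hcI (by fun_prop)) (hcI (by fun_prop)) fun t => ?_
    have hxy : ‖y - x‖ ≤ 2 := by
      have h1 : ‖x‖ < 1 := by simpa [ball5] using hx
      have h2 : ‖y‖ < 1 := by simpa [ball5] using hy
      linarith [norm_sub_le y x]
    have h3 := (fderiv ℝ f ((1 - t) • x + t • y)).le_opNorm (y - x)
    calc ‖fderiv ℝ f ((1 - t) • x + t • y) (y - x)‖ ^ 2
        ≤ (‖fderiv ℝ f ((1 - t) • x + t • y)‖ * 2) ^ 2 := by
          gcongr
          exact h3.trans (by gcongr)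
      _ = _ := by ring
  rw [integral_const_mul] at hle
  linarith

lemma lintegral_sub_midpoint_le {f : E5 → ℂ} (hf : ContDiff ℝ 1 f) {y : E5} (hy : y ∈ ball5) :
    ∫⁻ x in ball5, ENNReal.ofReal (‖f x - f ((1 / 2 : ℝ) • x + (1 / 2 : ℝ) • y)‖ ^ 2) ≤
      32 * ∫⁻ x in ball5, ENNReal.ofReal (‖fderiv ℝ f x‖ ^ 2) := by
  have hdc : Continuous (fderiv ℝ f) := hf.continuous_fderiv one_ne_zero
  set N : E5 → ℝ≥0∞ := fun x => ENNReal.ofReal (‖fderiv ℝ f x‖ ^ 2) with hN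
  have hNm : Measurable N := by fun_prop
  have h1 : ∀ x ∈ ball5, ENNReal.ofReal (‖f x - f ((1 / 2 : ℝ) • x + (1 / 2 : ℝ) • y)‖ ^ 2) ≤
      2 * ∫⁻ t in Ioc (0 : ℝ) (1 / 2), N ((1 - t) • x + t • y) := by
    intro x hx
    refine (ENNReal.ofReal_le_ofReal (sq_norm_sub_midpoint_le hf hx hy)).trans ?_
    rw [ENNReal.ofReal_mul (by norm_num), ofReal_integral_eq_lintegral_ofReal]
    · simp [hN]
    · exact Continuous.integrableOn_Ioc (by fun_prop)
    · exact Filter.Eventually.of_forall fun t => by positivity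
  have hNu : Measurable (Function.uncurry fun (x : E5) (t : ℝ) => N ((1 - t) • x + t • y)) := by
    exact hNm.comp (by fun_prop)
  calc _ ≤ ∫⁻ x in ball5, 2 * ∫⁻ t in Ioc (0 : ℝ) (1 / 2), N ((1 - t) • x + t • y) :=
        setLIntegral_mono' measurableSet_ball5 h1
    _ = 2 * ∫⁻ t in Ioc (0 : ℝ) (1 / 2), ∫⁻ x in ball5, N ((1 - t) • x + t • y) := by
        rw [lintegral_const_mul' _ _ (by norm_num), lintegral_lintegral_swap hNu.aemeasurable]
    _ ≤ 2 * ∫⁻ _t in Ioc (0 : ℝ) (1 / 2), 32 * ∫⁻ x in ball5, N x := by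
        gcongr 2 * ?_
        exact setLIntegral_mono' measurableSet_Ioc fun t ht => lintegral_contract_le hNm hy ht
    _ = 32 * ∫⁻ x in ball5, N x := by
        rw [setLIntegral_const, Real.volume_Ioc, mul_comm, mul_assoc]
        have : ENNReal.ofReal (1 / 2 - 0) * 2 = 1 := by
          have h2 : (2 : ℝ≥0∞) = ENNReal.ofReal 2 := by norm_num
          rw [h2, ← ENNReal.ofReal_mul (by norm_num)]
          norm_num
        rw [this, mul_one]

lemma lintegral_lintegral_sub_le {f : E5 → ℂ} (hf : ContDiff ℝ 1 f) :
    ∫⁻ x in ball5, ∫⁻ y in ball5, ENNReal.ofReal (‖f x - f y‖ ^ 2) ≤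
      128 * volume ball5 * ∫⁻ x in ball5, ENNReal.ofReal (‖fderiv ℝ f x‖ ^ 2) := by
  have hfc : Continuous f := hf.continuous
  set m : E5 → E5 → ℝ≥0∞ := fun x y =>
    ENNReal.ofReal (‖f x - f ((1 / 2 : ℝ) • x + (1 / 2 : ℝ) • y)‖ ^ 2) with hm
  set G := ∫⁻ x in ball5, ENNReal.ofReal (‖fderiv ℝ f x‖ ^ 2)
  have hmu : Measurable (Function.uncurry m) := by
    have : Continuous fun p : E5 × E5 =>
      ‖f p.1 - f ((1 / 2 : ℝ) • p.1 + (1 / 2 : ℝ) • p.2)‖ ^ 2 := by fun_prop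
    exact this.measurable.ennreal_ofReal
  have hpt : ∀ x y, ENNReal.ofReal (‖f x - f y‖ ^ 2) ≤ 2 * m x y + 2 * m y x := by
    intro x y
    have h2 : ∀ r : ℝ, 2 * ENNReal.ofReal r = ENNReal.ofReal (2 * r) := fun r => by
      rw [ENNReal.ofReal_mul (by norm_num), ENNReal.ofReal_ofNat]
    simp only [hm]
    rw [h2, h2, ← ENNReal.ofReal_add (by positivity) (by positivity)]
    refine ENNReal.ofReal_le_ofReal ?_
    rw [add_comm ((1 / 2 : ℝ) • y)]
    set z := f ((1 / 2 : ℝ) • x + (1 / 2 : ℝ) • y)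
    have h := norm_sub_le (f x - z) (f y - z)
    rw [sub_sub_sub_cancel_right] at h
    have h' := pow_le_pow_left₀ (norm_nonneg _) h 2
    nlinarith [sq_nonneg (‖f x - z‖ - ‖f y - z‖)]
  have hA : ∫⁻ y in ball5, ∫⁻ x in ball5, m x y ≤ 32 * volume ball5 * G := by
    calc _ ≤ ∫⁻ _y in ball5, 32 * G :=
          setLIntegral_mono' measurableSet_ball5 fun y hy => lintegral_sub_midpoint_le hf hy
      _ = _ := by rw [setLIntegral_const]; ring
  clear_value m G
  have hmx : ∀ x, Measurable fun y => m x y := fun x => hmu.comp measurable_prodMk_left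
  calc _ ≤ ∫⁻ x in ball5, ∫⁻ y in ball5, (2 * m x y + 2 * m y x) :=
        lintegral_mono fun x => lintegral_mono fun y => hpt x y
    _ = ∫⁻ x in ball5, (2 * (∫⁻ y in ball5, m x y) + 2 * ∫⁻ y in ball5, m y x) := by
        refine lintegral_congr fun x => ?_
        rw [lintegral_add_left ((hmx x).const_mul _), lintegral_const_mul' _ _ (by norm_num),
          lintegral_const_mul' _ _ (by norm_num)]
    _ = 2 * (∫⁻ x in ball5, ∫⁻ y in ball5, m x y) +
          2 * ∫⁻ x in ball5, ∫⁻ y in ball5, m y x := by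
        have hint : Measurable fun x => ∫⁻ y in ball5, m x y := hmu.lintegral_prod_right'
        rw [lintegral_add_left (hint.const_mul _),
          lintegral_const_mul' _ _ (by norm_num), lintegral_const_mul' _ _ (by norm_num)]
    _ ≤ 2 * (32 * volume ball5 * G) + 2 * (32 * volume ball5 * G) := by
        rw [lintegral_lintegral_swap hmu.aemeasurable]
        gcongr
    _ = _ := by ring

/-- The Poincaré inequality on the unit ball. -/
lemma integral_sub_average_le {f : E5 → ℂ} (hf : ContDiff ℝ 1 f) :
    bL2Sq (fun x => f x - ((volume : Measure E5).real ball5)⁻¹ • ∫ y in ball5, f y) ≤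
      128 * gradSq f := by
  have hfc : Continuous f := hf.continuous
  have hdc : Continuous (fderiv ℝ f) := hf.continuous_fderiv one_ne_zero
  set V := (volume : Measure E5).real ball5 with hV
  have hVpos : 0 < V := volume_ball5_pos
  set A := V⁻¹ • ∫ y in ball5, f y
  have hpt : ∀ x, ‖f x - A‖ ^ 2 ≤ V⁻¹ * ∫ y in ball5, ‖f x - f y‖ ^ 2 := by
    intro x
    have h1 : ∫ y in ball5, (f x - f y) = V • (f x - A) := by
      rw [integral_sub (integrable_const _) hfc.integrable_ball5, integral_const, smul_sub,
        smul_smul, mul_inv_cancel₀ hVpos.ne', one_smul, measureReal_restrict_apply_univ]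
    have h2 := sq_norm_integral_le (μ := volume.restrict ball5) (f := fun y => f x - f y)
      (Continuous.integrable_ball5 (by fun_prop)) (Continuous.integrable_ball5 (by fun_prop))
    rw [h1, norm_smul, Real.norm_of_nonneg hVpos.le, measureReal_restrict_apply_univ, ← hV] at h2
    rw [le_inv_mul_iff₀ hVpos]
    refine le_of_mul_le_mul_left ?_ hVpos
    calc _ = (V * ‖f x - A‖) ^ 2 := by ring
      _ ≤ _ := h2
  have hVe : ENNReal.ofReal V = volume ball5 := ENNReal.ofReal_toReal measure_ball_lt_top.ne
  have key : ∫⁻ x in ball5, ENNReal.ofReal (‖f x - A‖ ^ 2) ≤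
      ENNReal.ofReal V⁻¹ * (128 * volume ball5 *
        ∫⁻ x in ball5, ENNReal.ofReal (‖fderiv ℝ f x‖ ^ 2)) := by
    calc _ ≤ ∫⁻ x in ball5, ENNReal.ofReal V⁻¹ *
          ∫⁻ y in ball5, ENNReal.ofReal (‖f x - f y‖ ^ 2) := by
          refine lintegral_mono fun x => ?_
          refine (ENNReal.ofReal_le_ofReal (hpt x)).trans ?_
          rw [ENNReal.ofReal_mul (by positivity), ofReal_integral_eq_lintegral_ofReal
            (Continuous.integrable_ball5 (by fun_prop))
            (Filter.Eventually.of_forall fun t => by positivity)]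
      _ ≤ _ := by
          rw [lintegral_const_mul' _ _ ENNReal.ofReal_ne_top]
          gcongr
          exact lintegral_lintegral_sub_le hf
  have h128 : (128 : ℝ≥0∞) = ENNReal.ofReal 128 := by norm_num
  rw [← ofReal_integral_eq_lintegral_ofReal (Continuous.integrable_ball5 (by fun_prop))
    (Filter.Eventually.of_forall fun x => by positivity),
    ← ofReal_integral_eq_lintegral_ofReal (Continuous.integrable_ball5 (by fun_prop))
    (Filter.Eventually.of_forall fun x => by positivity), ← hVe, h128,
    ← ENNReal.ofReal_mul (by positivity), ← ENNReal.ofReal_mul (by positivity),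
    ← ENNReal.ofReal_mul (by positivity), ENNReal.ofReal_le_ofReal_iff (by positivity)] at key
  refine key.trans (le_of_eq ?_)
  rw [gradSq]
  field_simp

/-- The Poincaré inequality on the unit ball with the boundary mean as the lower order term. -/
lemma exists_poincare_const : ∃ C : ℝ, 0 < C ∧ ∀ f : E5 → ℂ, ContDiff ℝ 1 f →
    bL2Sq f ≤ C * (gradSq f + ‖∫ ω, f ω ∂surf‖ ^ 2) := by
  obtain ⟨Ct, hCt, htr⟩ := exists_trace_const
  set V := (volume : Measure E5).real ball5 with hV
  have hVpos : 0 < V := volume_ball5_pos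
  set M := surf.real univ with hM
  have hMpos : 0 < M := surf_real_univ_pos
  refine ⟨256 + 4 * V / M ^ 2 * (M * (Ct * 129) + 1), by positivity, fun f hf => ?_⟩
  have hfc : Continuous f := hf.continuous
  set A := V⁻¹ • ∫ y in ball5, f y
  set G := gradSq f
  set I := ∫ ω, f ω ∂surf
  have hG : 0 ≤ G := integral_nonneg fun x => by positivity
  have hP : bL2Sq (fun x => f x - A) ≤ 128 * G := integral_sub_average_le hf
  have hgrad : gradSq (fun x => f x - A) = G := by
    simp only [G, gradSq, fderiv_sub_const]
  have htA := htr (fun x => f x - A) (hf.sub contDiff_const)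
  rw [hgrad] at htA
  have hCS := sq_norm_integral_le (μ := surf) (f := fun y => f y - A)
      (Continuous.integrable_surf (by fun_prop)) (Continuous.integrable_surf (by fun_prop))
  rw [integral_sub hfc.integrable_surf (integrable_const _), integral_const, ← hM] at hCS
  have h1 : ‖I - M • A‖ ^ 2 ≤ M * (Ct * 129) * G := by
    calc _ ≤ _ := hCS
      _ ≤ M * (Ct * (128 * G + G)) := by
        gcongr
        exact htA.trans (by gcongr)
      _ = _ := by ring
  have h2 : M ^ 2 * ‖A‖ ^ 2 ≤ 2 * (M * (Ct * 129) * G) + 2 * ‖I‖ ^ 2 := by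
    have h := norm_sub_le I (I - M • A)
    rw [sub_sub_cancel, norm_smul, Real.norm_of_nonneg hMpos.le] at h
    have h' := pow_le_pow_left₀ (by positivity) h 2
    nlinarith [sq_nonneg (‖I‖ - ‖I - M • A‖)]
  have h3 : bL2Sq f ≤ 2 * bL2Sq (fun x => f x - A) + 2 * (V * ‖A‖ ^ 2) := by
    have : ∫ _x in ball5, ‖A‖ ^ 2 = V * ‖A‖ ^ 2 := by
      rw [setIntegral_const, smul_eq_mul]
    rw [← this]
    simp only [bL2Sq]
    rw [← integral_const_mul, ← integral_const_mul, ← integral_add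
      (Continuous.integrable_ball5 (by fun_prop)) (Continuous.integrable_ball5 (by fun_prop))]
    refine integral_mono (Continuous.integrable_ball5 (by fun_prop))
      (Continuous.integrable_ball5 (by fun_prop)) fun x => ?_
    have h := norm_add_le (f x - A) A
    rw [sub_add_cancel] at h
    have h' := pow_le_pow_left₀ (norm_nonneg _) h 2
    dsimp only
    nlinarith [sq_nonneg (‖f x - A‖ - ‖A‖)]
  have h4 : 2 * (V * ‖A‖ ^ 2) ≤ 4 * V / M ^ 2 * (M * (Ct * 129) * G + ‖I‖ ^ 2) := by
    calc 2 * (V * ‖A‖ ^ 2) = 2 * V / M ^ 2 * (M ^ 2 * ‖A‖ ^ 2) := by field_simp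
      _ ≤ 2 * V / M ^ 2 * (2 * (M * (Ct * 129) * G) + 2 * ‖I‖ ^ 2) := by gcongr
      _ = _ := by ring
  have h5 : M * (Ct * 129) * G + ‖I‖ ^ 2 ≤ (M * (Ct * 129) + 1) * (G + ‖I‖ ^ 2) := by
    have : 0 ≤ M * (Ct * 129) * ‖I‖ ^ 2 := by positivity
    nlinarith
  have h6 : 4 * V / M ^ 2 * (M * (Ct * 129) * G + ‖I‖ ^ 2) ≤
      4 * V / M ^ 2 * ((M * (Ct * 129) + 1) * (G + ‖I‖ ^ 2)) := by gcongr
  have h7 : 0 ≤ ‖I‖ ^ 2 := by positivity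
  linarith

lemma ContDiff.pd {n : ℕ} {f : E5 → ℂ} (hf : ContDiff ℝ (n + 1 : ℕ) f) (i : Fin 5) :
    ContDiff ℝ n (pd i f) :=
  (hf.fderiv_right (m := n) (by norm_cast)).clm_apply contDiff_const

lemma pd_comm {f : E5 → ℂ} (hf : ContDiff ℝ 2 f) (i j : Fin 5) :
    pd i (pd j f) = pd j (pd i f) := by
  have key : ∀ (a b : Fin 5) (x : E5), pd a (pd b f) x =
      fderiv ℝ (fderiv ℝ f) x (EuclideanSpace.single a 1) (EuclideanSpace.single b 1) := by
    intro a b x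
    have hd : DifferentiableAt ℝ (fderiv ℝ f) x :=
      (hf.fderiv_right (m := 1) (by norm_num)).differentiable one_ne_zero x
    have h := hd.hasFDerivAt.clm_apply (hasFDerivAt_const (EuclideanSpace.single b (1 : ℝ)) x)
    change fderiv ℝ (fun y => fderiv ℝ f y (EuclideanSpace.single b 1)) x _ = _
    rw [h.fderiv]
    simp
  ext x
  rw [key, key]
  exact (hf.contDiffAt.isSymmSndFDerivAt (by simp)) _ _

/-- Iterated partial derivatives along a list of directions. -/
def pdL (l : List (Fin 5)) (f : E5 → ℂ) : E5 → ℂ := l.foldr pd f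

lemma contDiff_pdL {f : E5 → ℂ} (l : List (Fin 5)) (k : ℕ)
    (hf : ContDiff ℝ (l.length + k : ℕ) f) : ContDiff ℝ k (pdL l f) := by
  induction l generalizing k with
  | nil => simpa [pdL] using hf
  | cons i l ih =>
    refine (ih (k + 1) ?_).pd i
    convert hf using 2
    simp only [List.length_cons]
    omega

lemma pdL_perm {f : E5 → ℂ} {l l' : List (Fin 5)} (h : l.Perm l')
    (hf : ContDiff ℝ (l.length : ℕ) f) : pdL l f = pdL l' f := by
  induction h with
  | nil => rfl
  | cons i _ ih =>
    have := ih (hf.of_le (by simp only [List.length_cons]; norm_cast; omega))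
    simp only [pdL, List.foldr_cons] at this ⊢
    rw [this]
  | swap i j l => exact pd_comm (contDiff_pdL l 2 hf) j i
  | trans h₁ _ ih₁ ih₂ => exact (ih₁ hf).trans (ih₂ (by rwa [← h₁.length_eq]))

/-- The ordered list of directions corresponding to a multi-index. -/
def dirList (β : Fin 5 → ℕ) : List (Fin 5) :=
  (List.finRange 5).flatMap fun i => List.replicate (β i) i

lemma pdM_eq_pdL (β : Fin 5 → ℕ) (f : E5 → ℂ) : pdM β f = pdL (dirList β) f := by
  have hrep : ∀ (i : Fin 5) (n : ℕ) (g : E5 → ℂ),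
      (List.replicate n i).foldr pd g = (pd i)^[n] g := by
    intro i n g
    induction n with
    | zero => rfl
    | succ n ih => rw [List.replicate_succ, List.foldr_cons, ih, Function.iterate_succ_apply']
  have : ∀ L : List (Fin 5), L.foldr (fun i g => (pd i)^[β i] g) f =
      (L.flatMap fun i => List.replicate (β i) i).foldr pd f := by
    intro L
    induction L with
    | nil => rfl
    | cons i L ih => rw [List.foldr_cons, ih, List.flatMap_cons, List.foldr_append, hrep]
  exact this _

lemma length_dirList (β : Fin 5 → ℕ) : (dirList β).length = ∑ i, β i := by
  rw [dirList, List.length_flatMap, Fin.sum_univ_def]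
  simp

lemma count_dirList (β : Fin 5 → ℕ) (i : Fin 5) : (dirList β).count i = β i := by
  rw [dirList, List.count_flatMap, ← Fin.sum_univ_def]
  simp [List.count_replicate]

lemma bL2Sq_nonneg (f : E5 → ℂ) : 0 ≤ bL2Sq f := integral_nonneg fun x => by positivity

lemma bL2Sq_pdL_le_HSq {m : ℕ} {f : E5 → ℂ} (hf : ContDiff ℝ m f) {l : List (Fin 5)}
    (hl : l.length ≤ m) : bL2Sq (pdL l f) ≤ HSq m f := by
  let β : Fin 5 → Fin (m + 1) := fun i =>
    ⟨l.count i, Nat.lt_succ_of_le (List.count_le_length.trans hl)⟩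
  have hperm : l.Perm (dirList fun i => (β i : ℕ)) := by
    rw [List.perm_iff_count]
    intro i
    rw [count_dirList]
  have hsum : ∑ i, (β i : ℕ) ≤ m := by
    rw [← length_dirList, ← hperm.length_eq]
    exact hl
  have h := Finset.single_le_sum (s := Finset.univ)
    (f := fun β : Fin 5 → Fin (m + 1) =>
      if (∑ i, (β i : ℕ)) ≤ m then bL2Sq (pdM (fun i => (β i : ℕ)) f) else 0)
    (fun γ _ => by
      split_ifs
      · exact bL2Sq_nonneg _
      · exact le_rfl) (Finset.mem_univ β)
  rw [if_pos hsum, pdM_eq_pdL, ← pdL_perm hperm (hf.of_le (by exact_mod_cast hl))] at h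
  exact h

lemma HSq_le {m : ℕ} {f : E5 → ℂ} {Q : ℝ}
    (hQ : ∀ l : List (Fin 5), l.length ≤ m → bL2Sq (pdL l f) ≤ Q) :
    HSq m f ≤ Fintype.card (Fin 5 → Fin (m + 1)) * Q := by
  have hQ0 : 0 ≤ Q := (bL2Sq_nonneg _).trans (hQ [] (Nat.zero_le _))
  rw [HSq, ← nsmul_eq_mul, ← Finset.card_univ]
  refine Finset.sum_le_card_nsmul _ _ _ fun β _ => ?_
  split_ifs with h
  · rw [pdM_eq_pdL]
    exact hQ _ (by rwa [length_dirList])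
  · exact hQ0

lemma HSq_nonneg (m : ℕ) (f : E5 → ℂ) : 0 ≤ HSq m f := by
  refine Finset.sum_nonneg fun β _ => ?_
  split_ifs
  · exact bL2Sq_nonneg _
  · exact le_rfl

/-- Sum of squared `L²` norms of the first derivatives. -/
def dSq1 (f : E5 → ℂ) : ℝ := ∑ i, bL2Sq (pd i f)

/-- Sum of squared `L²` norms of the second derivatives. -/
def dSq2 (f : E5 → ℂ) : ℝ := ∑ i, ∑ j, bL2Sq (pd i (pd j f))

/-- Sum of squared `L²` norms of the third derivatives. -/
def dSq3 (f : E5 → ℂ) : ℝ := ∑ i, ∑ j, ∑ k, bL2Sq (pd i (pd j (pd k f)))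

/-- The squared `L²` norm over the unit sphere. -/
def sSq (f : E5 → ℂ) : ℝ := ∫ ω, ‖f ω‖ ^ 2 ∂surf

/-- Sum of squared boundary `L²` norms of the first derivatives. -/
def sSq1 (f : E5 → ℂ) : ℝ := ∑ i, sSq (pd i f)

/-- Sum of squared boundary `L²` norms of the second derivatives. -/
def sSq2 (f : E5 → ℂ) : ℝ := ∑ i, ∑ j, sSq (pd i (pd j f))

lemma sSq_nonneg (f : E5 → ℂ) : 0 ≤ sSq f := integral_nonneg fun x => by positivity

lemma sSq1_nonneg (f : E5 → ℂ) : 0 ≤ sSq1 f := Finset.sum_nonneg fun _ _ => sSq_nonneg _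

lemma sSq2_nonneg (f : E5 → ℂ) : 0 ≤ sSq2 f :=
  Finset.sum_nonneg fun _ _ => Finset.sum_nonneg fun _ _ => sSq_nonneg _

lemma dSq1_nonneg (f : E5 → ℂ) : 0 ≤ dSq1 f := Finset.sum_nonneg fun _ _ => bL2Sq_nonneg _

lemma dSq2_nonneg (f : E5 → ℂ) : 0 ≤ dSq2 f :=
  Finset.sum_nonneg fun _ _ => Finset.sum_nonneg fun _ _ => bL2Sq_nonneg _

lemma dSq3_nonneg (f : E5 → ℂ) : 0 ≤ dSq3 f :=
  Finset.sum_nonneg fun _ _ => Finset.sum_nonneg fun _ _ =>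
    Finset.sum_nonneg fun _ _ => bL2Sq_nonneg _

lemma bL2Sq_pd_le_dSq1 (f : E5 → ℂ) (i : Fin 5) : bL2Sq (pd i f) ≤ dSq1 f :=
  Finset.single_le_sum (f := fun i => bL2Sq (pd i f)) (fun _ _ => bL2Sq_nonneg _)
    (Finset.mem_univ i)

lemma dSq2_eq (f : E5 → ℂ) : dSq2 f = ∑ j, dSq1 (pd j f) := Finset.sum_comm

lemma dSq3_eq (f : E5 → ℂ) : dSq3 f = ∑ k, dSq2 (pd k f) := by
  simp only [dSq3, dSq2]
  exact (Finset.sum_congr rfl fun i _ => Finset.sum_comm).trans Finset.sum_comm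

lemma bL2Sq_pd_pd_le_dSq2 (f : E5 → ℂ) (i j : Fin 5) : bL2Sq (pd i (pd j f)) ≤ dSq2 f := by
  rw [dSq2_eq]
  exact (bL2Sq_pd_le_dSq1 _ i).trans (Finset.single_le_sum (f := fun j => dSq1 (pd j f))
    (fun _ _ => dSq1_nonneg _) (Finset.mem_univ j))

lemma bL2Sq_pd_pd_pd_le_dSq3 (f : E5 → ℂ) (i j k : Fin 5) :
    bL2Sq (pd i (pd j (pd k f))) ≤ dSq3 f := by
  rw [dSq3_eq]
  exact (bL2Sq_pd_pd_le_dSq2 _ i j).trans (Finset.single_le_sum (f := fun j => dSq2 (pd j f))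
    (fun _ _ => dSq2_nonneg _) (Finset.mem_univ k))

lemma HSq_two_le (f : E5 → ℂ) : HSq 2 f ≤ 243 * (bL2Sq f + dSq1 f + dSq2 f) := by
  have h := HSq_le (m := 2) (f := f) (Q := bL2Sq f + dSq1 f + dSq2 f) fun l hl => by
    have h0 := bL2Sq_nonneg f
    have h1 := dSq1_nonneg f
    have h2 := dSq2_nonneg f
    match l, hl with
    | [], _ => simp only [pdL, List.foldr_nil]; linarith
    | [i], _ => have := bL2Sq_pd_le_dSq1 f i; simp only [pdL, List.foldr]; linarith
    | [i, j], _ => have := bL2Sq_pd_pd_le_dSq2 f i j; simp only [pdL, List.foldr]; linarith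
    | _ :: _ :: _ :: _, hl => simp at hl
  simpa using h

lemma HSq_three_le (f : E5 → ℂ) : HSq 3 f ≤ 1024 * (bL2Sq f + dSq1 f + dSq2 f + dSq3 f) := by
  have h := HSq_le (m := 3) (f := f) (Q := bL2Sq f + dSq1 f + dSq2 f + dSq3 f) fun l hl => by
    have h0 := bL2Sq_nonneg f
    have h1 := dSq1_nonneg f
    have h2 := dSq2_nonneg f
    have h3 := dSq3_nonneg f
    match l, hl with
    | [], _ => simp only [pdL, List.foldr_nil]; linarith
    | [i], _ => have := bL2Sq_pd_le_dSq1 f i; simp only [pdL, List.foldr]; linarith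
    | [i, j], _ => have := bL2Sq_pd_pd_le_dSq2 f i j; simp only [pdL, List.foldr]; linarith
    | [i, j, k], _ => have := bL2Sq_pd_pd_pd_le_dSq3 f i j k; simp only [pdL, List.foldr]; linarith
    | _ :: _ :: _ :: _ :: _, hl => simp only [List.length_cons] at hl; omega
  simpa using h

lemma bL2Sq_le_HSq {m : ℕ} {f : E5 → ℂ} (hf : ContDiff ℝ m f) : bL2Sq f ≤ HSq m f :=
  bL2Sq_pdL_le_HSq hf (l := []) (Nat.zero_le _)

lemma dSq1_le_HSq {m : ℕ} {f : E5 → ℂ} (hf : ContDiff ℝ m f) (hm : 1 ≤ m) :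
    dSq1 f ≤ 5 * HSq m f := by
  have := Finset.sum_le_card_nsmul Finset.univ (fun i => bL2Sq (pd i f)) (HSq m f) fun i _ =>
    bL2Sq_pdL_le_HSq hf (l := [i]) hm
  simpa [dSq1] using this

lemma dSq2_le_HSq {m : ℕ} {f : E5 → ℂ} (hf : ContDiff ℝ m f) (hm : 2 ≤ m) :
    dSq2 f ≤ 25 * HSq m f := by
  calc dSq2 f ≤ ∑ _i : Fin 5, ∑ _j : Fin 5, HSq m f :=
        Finset.sum_le_sum fun i _ => Finset.sum_le_sum fun j _ =>
          bL2Sq_pdL_le_HSq hf (l := [i, j]) hm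
    _ = _ := by simp; ring

lemma dSq3_le_HSq {m : ℕ} {f : E5 → ℂ} (hf : ContDiff ℝ m f) (hm : 3 ≤ m) :
    dSq3 f ≤ 125 * HSq m f := by
  calc dSq3 f ≤ ∑ _i : Fin 5, ∑ _j : Fin 5, ∑ _k : Fin 5, HSq m f :=
        Finset.sum_le_sum fun i _ => Finset.sum_le_sum fun j _ => Finset.sum_le_sum fun k _ =>
          bL2Sq_pdL_le_HSq hf (l := [i, j, k]) hm
    _ = _ := by simp; ring

lemma sq_norm_fderiv_le (f : E5 → ℂ) (x : E5) : ‖fderiv ℝ f x‖ ^ 2 ≤ ∑ i, ‖pd i f x‖ ^ 2 := by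
  have hs : 0 ≤ ∑ i, ‖pd i f x‖ ^ 2 := Finset.sum_nonneg fun i _ => by positivity
  rw [← Real.sqrt_le_sqrt_iff hs, Real.sqrt_sq (norm_nonneg _)]
  refine ContinuousLinearMap.opNorm_le_bound _ (Real.sqrt_nonneg _) fun v => ?_
  have hv : v = ∑ i, v i • EuclideanSpace.single i (1 : ℝ) := by
    ext k
    simp [Finset.sum_apply, Pi.single_apply]
  have h1 : fderiv ℝ f x v = ∑ i, v i • pd i f x := by
    conv_lhs => rw [hv]
    simp [pd]
  rw [h1, EuclideanSpace.norm_eq v, mul_comm]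
  refine (norm_sum_le _ _).trans ?_
  simp_rw [norm_smul]
  exact Real.sum_mul_le_sqrt_mul_sqrt _ _ _

lemma continuous_pd {f : E5 → ℂ} (hf : ContDiff ℝ 1 f) (i : Fin 5) : Continuous (pd i f) :=
  (hf.continuous_fderiv one_ne_zero).clm_apply continuous_const

lemma gradSq_le_dSq1 {f : E5 → ℂ} (hf : ContDiff ℝ 1 f) : gradSq f ≤ dSq1 f := by
  have hdc : Continuous (fderiv ℝ f) := hf.continuous_fderiv one_ne_zero
  have hp : ∀ i, Integrable (fun x => ‖pd i f x‖ ^ 2) (volume.restrict ball5) := fun i =>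
    ((continuous_pd hf i).norm.pow 2).integrable_ball5
  simp only [dSq1, bL2Sq]
  rw [← integral_finsetSum _ fun i _ => hp i]
  exact integral_mono (Continuous.integrable_ball5 (by fun_prop))
    (integrable_finsetSum _ fun i _ => hp i) fun x => sq_norm_fderiv_le f x

lemma sq_norm_surf_integral_le {f : E5 → ℂ} (hf : Continuous f) :
    ‖∫ ω, f ω ∂surf‖ ^ 2 ≤ surf.real univ * sSq f :=
  sq_norm_integral_le hf.integrable_surf (hf.norm.pow 2).integrable_surf

lemma exists_sSq_le : ∃ C : ℝ, 0 < C ∧ ∀ f : E5 → ℂ, ContDiff ℝ 1 f →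
    sSq f ≤ C * (bL2Sq f + dSq1 f) := by
  obtain ⟨C, hC, h⟩ := exists_trace_const
  refine ⟨C, hC, fun f hf => (h f hf).trans ?_⟩
  gcongr
  exact gradSq_le_dSq1 hf

lemma exists_bL2Sq_le : ∃ C : ℝ, 0 < C ∧ ∀ f : E5 → ℂ, ContDiff ℝ 1 f →
    bL2Sq f ≤ C * (dSq1 f + ‖∫ ω, f ω ∂surf‖ ^ 2) := by
  obtain ⟨C, hC, h⟩ := exists_poincare_const
  refine ⟨C, hC, fun f hf => (h f hf).trans ?_⟩
  gcongr
  exact gradSq_le_dSq1 hf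

lemma exists_bL2Sq_le_sSq : ∃ C : ℝ, 0 < C ∧ ∀ f : E5 → ℂ, ContDiff ℝ 1 f →
    bL2Sq f ≤ C * (dSq1 f + sSq f) := by
  obtain ⟨C, hC, h⟩ := exists_bL2Sq_le
  have hM := surf_real_univ_pos
  refine ⟨C * (1 + surf.real univ), by positivity, fun f hf => (h f hf).trans ?_⟩
  rw [mul_assoc]
  gcongr
  have h1 := sq_norm_surf_integral_le hf.continuous
  have h2 := mul_nonneg hM.le (dSq1_nonneg f)
  have h3 := sSq_nonneg f
  linarith

lemma integral_mul_conj_self {α : Type*} [MeasurableSpace α] (μ : Measure α) (g : α → ℂ) :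
    ∫ x, g x * conj (g x) ∂μ = ((∫ x, ‖g x‖ ^ 2 ∂μ : ℝ) : ℂ) := by
  rw [← integral_complex_ofReal]
  simp [Complex.mul_conj']

lemma integral_mul_conj_symm {α : Type*} [MeasurableSpace α] (μ : Measure α) (f g : α → ℂ) :
    ∫ x, f x * conj (g x) ∂μ = conj (∫ x, g x * conj (f x) ∂μ) := by
  rw [← integral_conj]
  simp [mul_comm]

/-- The value of the quadratic form `u ↦ (u|u)` as a real number. -/
def energy (u : (E5 → ℂ) × (E5 → ℂ)) : ℝ :=
  7 * (dSq3 u.1 + dSq2 u.2 + sSq2 u.1) + 3 * (dSq1 (lap u.1) + dSq2 u.2 + sSq1 u.2) +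
    sSq u.2 + sSq1 u.1 + ‖∫ ω, zeta u ω ∂surf‖ ^ 2

lemma ipT_self (u : (E5 → ℂ) × (E5 → ℂ)) : ipT u u = (energy u : ℂ) := by
  simp only [ipT, ip1, ip2, ip3, ip4, ip5, integral_mul_conj_self, energy,
    dSq1, dSq2, dSq3, sSq, sSq1, sSq2, bL2Sq]
  rw [Complex.mul_conj']
  simp only [Complex.ofReal_add, Complex.ofReal_mul, Complex.ofReal_sum, Complex.ofReal_pow,
    Complex.ofReal_ofNat]
  ring

lemma ipT_conj_symm (u v : (E5 → ℂ) × (E5 → ℂ)) : ipT u v = conj (ipT v u) := by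
  have h1 : ip1 u v = conj (ip1 v u) := by
    simp only [ip1, map_add, map_sum, ← integral_mul_conj_symm]
  have h2 : ip2 u v = conj (ip2 v u) := by
    simp only [ip2, map_add, map_sum, ← integral_mul_conj_symm]
  have h3 : ip3 u v = conj (ip3 v u) := by
    simp only [ip3, map_add, map_mul, map_ofNat, ← integral_mul_conj_symm, h1, h2]
  have h4 : ip4 u v = conj (ip4 v u) := by
    simp only [ip4, map_add, map_sum, ← integral_mul_conj_symm, h1, h2]
  have h5 : ip5 u v = conj (ip5 v u) := by
    simp only [ip5, map_mul, Complex.conj_conj, mul_comm]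
  simp only [ipT, map_add, ← h1, ← h2, ← h3, ← h4, ← h5]

lemma sq_sum_norm_le (f : Fin 5 → ℂ) : (∑ i, ‖f i‖) ^ 2 ≤ 5 * ∑ i, ‖f i‖ ^ 2 := by
  simpa using sq_sum_le_card_mul_sum_sq (s := Finset.univ) (f := fun i => ‖f i‖)

lemma contDiff_one_pd {f : E5 → ℂ} (hf : ContDiff ℝ 2 f) (i : Fin 5) : ContDiff ℝ 1 (pd i f) :=
  mod_cast ContDiff.pd (n := 1) (mod_cast hf) i

lemma contDiff_two_pd {f : E5 → ℂ} (hf : ContDiff ℝ 3 f) (i : Fin 5) : ContDiff ℝ 2 (pd i f) :=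
  mod_cast ContDiff.pd (n := 2) (mod_cast hf) i

lemma pd_lap {f : E5 → ℂ} (hf : ContDiff ℝ 3 f) (i : Fin 5) (x : E5) :
    pd i (lap f) x = ∑ j, pd i (pd j (pd j f)) x := by
  have h : ∀ j, DifferentiableAt ℝ (pd j (pd j f)) x := fun j =>
    (contDiff_one_pd (contDiff_two_pd hf j) j).differentiable one_ne_zero x
  change fderiv ℝ (fun x => ∑ j, pd j (pd j f) x) x _ = _
  rw [fderiv_fun_sum fun j _ => h j]
  simp [pd]

lemma dSq1_lap_le {f : E5 → ℂ} (hf : ContDiff ℝ 3 f) : dSq1 (lap f) ≤ 5 * dSq3 f := by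
  have hc : ∀ i j k, Continuous (pd i (pd j (pd k f))) := fun i j k =>
    continuous_pd (contDiff_one_pd (contDiff_two_pd hf k) j) i
  have hint : ∀ i j k, Integrable (fun x => ‖pd i (pd j (pd k f)) x‖ ^ 2)
      (volume.restrict ball5) := fun i j k => ((hc i j k).norm.pow 2).integrable_ball5
  have key : ∀ i, bL2Sq (pd i (lap f)) ≤ 5 * ∑ j, bL2Sq (pd i (pd j (pd j f))) := by
    intro i
    simp only [bL2Sq]
    rw [← integral_finsetSum _ fun j _ => hint i j j, ← integral_const_mul]
    refine integral_mono_of_nonneg (.of_forall fun x => by positivity)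
      ((integrable_finsetSum _ fun j _ => hint i j j).const_mul 5) (.of_forall fun x => ?_)
    simp only [pd_lap hf]
    exact (pow_le_pow_left₀ (norm_nonneg _) (norm_sum_le _ _) 2).trans (sq_sum_norm_le _)
  rw [dSq1, dSq3, Finset.mul_sum]
  refine Finset.sum_le_sum fun i _ => (key i).trans ?_
  gcongr with j
  exact Finset.single_le_sum (f := fun k => bL2Sq (pd i (pd j (pd k f))))
    (fun _ _ => bL2Sq_nonneg _) (Finset.mem_univ j)

/-- `ζ` without its zeroth-order term in the first component. -/
def zetaTail (w : (E5 → ℂ) × (E5 → ℂ)) (ω : E5) : ℂ :=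
  (∑ i : Fin 5, ∑ j : Fin 5, (ω i : ℂ) * (ω j : ℂ) * pd i (pd j w.1) ω) +
    5 * (∑ i : Fin 5, (ω i : ℂ) * pd i w.1 ω) +
    (∑ j : Fin 5, (ω j : ℂ) * pd j w.2 ω) + 3 * w.2 ω

lemma zeta_eq (w : (E5 → ℂ) × (E5 → ℂ)) (ω : E5) : zeta w ω = 3 * w.1 ω + zetaTail w ω := by
  rw [zeta, zetaTail]
  ring

lemma sq_norm_zetaTail_le (w : (E5 → ℂ) × (E5 → ℂ)) {ω : E5} (hω : ω ∈ sph4) :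
    ‖zetaTail w ω‖ ^ 2 ≤ 500 * ((∑ i, ∑ j, ‖pd i (pd j w.1) ω‖ ^ 2) + (∑ i, ‖pd i w.1 ω‖ ^ 2) +
      (∑ i, ‖pd i w.2 ω‖ ^ 2) + ‖w.2 ω‖ ^ 2) := by
  have hle : ∀ i, ‖(ω i : ℂ)‖ ≤ 1 := fun i => by
    rw [Complex.norm_real, ← (mem_sphere_zero_iff_norm.1 hω : ‖ω‖ = 1)]
    exact PiLp.norm_apply_le ω i
  have hmul : ∀ (i : Fin 5) (z : ℂ), ‖(ω i : ℂ) * z‖ ≤ ‖z‖ := fun i z => by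
    rw [norm_mul]
    exact mul_le_of_le_one_left (norm_nonneg _) (hle i)
  have hlin : ∀ g : Fin 5 → ℂ, ‖∑ i, (ω i : ℂ) * g i‖ ^ 2 ≤ 5 * ∑ i, ‖g i‖ ^ 2 := fun g =>
    (pow_le_pow_left₀ (norm_nonneg _) ((norm_sum_le _ _).trans
      (Finset.sum_le_sum fun i _ => hmul i (g i))) 2).trans (sq_sum_norm_le g)
  have hquad : ‖∑ i : Fin 5, ∑ j : Fin 5, (ω i : ℂ) * (ω j : ℂ) * pd i (pd j w.1) ω‖ ^ 2 ≤
      25 * ∑ i, ∑ j, ‖pd i (pd j w.1) ω‖ ^ 2 := by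
    have h := hlin fun i => ∑ j, (ω j : ℂ) * pd i (pd j w.1) ω
    simp only [Finset.mul_sum, ← mul_assoc] at h ⊢
    refine h.trans (Finset.sum_le_sum fun i _ => ?_)
    have := hlin fun j => pd i (pd j w.1) ω
    rw [← Finset.mul_sum]
    linarith
  have h1 := hlin fun i => pd i w.1 ω
  have h2 := hlin fun i => pd i w.2 ω
  have hA : 0 ≤ ∑ i, ∑ j, ‖pd i (pd j w.1) ω‖ ^ 2 := by positivity
  have hB : 0 ≤ ∑ i, ‖pd i w.2 ω‖ ^ 2 := by positivity
  rw [zetaTail]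
  set a := ∑ i : Fin 5, ∑ j : Fin 5, (ω i : ℂ) * (ω j : ℂ) * pd i (pd j w.1) ω
  set b := ∑ i : Fin 5, (ω i : ℂ) * pd i w.1 ω
  set c := ∑ j : Fin 5, (ω j : ℂ) * pd j w.2 ω
  have hn : ‖a + 5 * b + c + 3 * w.2 ω‖ ≤ ‖a‖ + 5 * ‖b‖ + ‖c‖ + 3 * ‖w.2 ω‖ := by
    refine (norm_add₄_le).trans ?_
    simp
  refine (pow_le_pow_left₀ (norm_nonneg _) hn 2).trans ?_
  nlinarith [sq_nonneg (‖a‖ - 5 * ‖b‖), sq_nonneg (‖a‖ - ‖c‖), sq_nonneg (‖a‖ - 3 * ‖w.2 ω‖),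
    sq_nonneg (5 * ‖b‖ - ‖c‖), sq_nonneg (5 * ‖b‖ - 3 * ‖w.2 ω‖),
    sq_nonneg (‖c‖ - 3 * ‖w.2 ω‖), sq_nonneg ‖w.2 ω‖]

lemma continuous_zetaTail {w : (E5 → ℂ) × (E5 → ℂ)} (h1 : ContDiff ℝ 3 w.1)
    (h2 : ContDiff ℝ 2 w.2) : Continuous (zetaTail w) := by
  have hc2 : ∀ i j, Continuous (pd i (pd j w.1)) := fun i j =>
    (contDiff_one_pd (contDiff_two_pd h1 j) i).continuous
  have hc1 : ∀ i, Continuous (pd i w.1) := fun i => (contDiff_two_pd h1 i).continuous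
  have hd1 : ∀ i, Continuous (pd i w.2) := fun i => (contDiff_one_pd h2 i).continuous
  have hd0 := h2.continuous
  unfold zetaTail
  fun_prop

lemma sq_norm_integral_zetaTail_le {w : (E5 → ℂ) × (E5 → ℂ)} (h1 : ContDiff ℝ 3 w.1)
    (h2 : ContDiff ℝ 2 w.2) :
    ‖∫ ω, zetaTail w ω ∂surf‖ ^ 2 ≤
      500 * surf.real univ * (sSq2 w.1 + sSq1 w.1 + sSq1 w.2 + sSq w.2) := by
  have hc2 : ∀ i j, Integrable (fun ω => ‖pd i (pd j w.1) ω‖ ^ 2) surf := fun i j =>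
    ((contDiff_one_pd (contDiff_two_pd h1 j) i).continuous.norm.pow 2).integrable_surf
  have hc1 : ∀ i, Integrable (fun ω => ‖pd i w.1 ω‖ ^ 2) surf := fun i =>
    ((contDiff_two_pd h1 i).continuous.norm.pow 2).integrable_surf
  have hd1 : ∀ i, Integrable (fun ω => ‖pd i w.2 ω‖ ^ 2) surf := fun i =>
    ((contDiff_one_pd h2 i).continuous.norm.pow 2).integrable_surf
  have hd0 : Integrable (fun ω => ‖w.2 ω‖ ^ 2) surf := (h2.continuous.norm.pow 2).integrable_surf
  have hs2 := integrable_finsetSum Finset.univ fun i _ =>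
    integrable_finsetSum Finset.univ fun j _ => hc2 i j
  have hs1 := integrable_finsetSum Finset.univ fun i _ => hc1 i
  have ht1 := integrable_finsetSum Finset.univ fun i _ => hd1 i
  refine (sq_norm_surf_integral_le (continuous_zetaTail h1 h2)).trans ?_
  have hM := surf_real_univ_pos
  rw [mul_comm (500 : ℝ), mul_assoc]
  gcongr
  have key : sSq (zetaTail w) ≤ ∫ ω, 500 * ((∑ i, ∑ j, ‖pd i (pd j w.1) ω‖ ^ 2) +
      (∑ i, ‖pd i w.1 ω‖ ^ 2) + (∑ i, ‖pd i w.2 ω‖ ^ 2) + ‖w.2 ω‖ ^ 2) ∂surf := by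
    refine integral_mono_ae ((continuous_zetaTail h1 h2).norm.pow 2).integrable_surf
      ((((hs2.fun_add hs1).fun_add ht1).fun_add hd0).const_mul 500) ?_
    filter_upwards [ae_restrict_mem measurableSet_sph4] with ω hω
    exact sq_norm_zetaTail_le w hω
  refine key.trans_eq ?_
  rw [integral_const_mul, integral_add ((hs2.fun_add hs1).fun_add ht1) hd0,
    integral_add (hs2.fun_add hs1) ht1, integral_add hs2 hs1,
    integral_finsetSum _ fun i _ => integrable_finsetSum Finset.univ fun j _ => hc2 i j,
    integral_finsetSum _ fun i _ => hc1 i, integral_finsetSum _ fun i _ => hd1 i]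
  simp_rw [integral_finsetSum _ fun j _ => hc2 _ j]
  rfl

lemma integral_zeta {w : (E5 → ℂ) × (E5 → ℂ)} (h1 : ContDiff ℝ 3 w.1) (h2 : ContDiff ℝ 2 w.2) :
    ∫ ω, zeta w ω ∂surf = 3 * (∫ ω, w.1 ω ∂surf) + ∫ ω, zetaTail w ω ∂surf := by
  simp_rw [zeta_eq]
  rw [integral_add (h1.continuous.integrable_surf.const_mul 3)
    (continuous_zetaTail h1 h2).integrable_surf, integral_const_mul]

lemma exists_dSq1_le : ∃ C : ℝ, 0 < C ∧ ∀ f : E5 → ℂ, ContDiff ℝ 2 f →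
    dSq1 f ≤ C * (dSq2 f + sSq1 f) := by
  obtain ⟨C, hC, h⟩ := exists_bL2Sq_le_sSq
  refine ⟨C, hC, fun f hf => ?_⟩
  rw [dSq2_eq, sSq1, ← Finset.sum_add_distrib, Finset.mul_sum]
  exact Finset.sum_le_sum fun i _ => h _ (contDiff_one_pd hf i)

lemma sSq2_eq (f : E5 → ℂ) : sSq2 f = ∑ j, sSq1 (pd j f) := Finset.sum_comm

lemma exists_dSq2_le : ∃ C : ℝ, 0 < C ∧ ∀ f : E5 → ℂ, ContDiff ℝ 3 f →
    dSq2 f ≤ C * (dSq3 f + sSq2 f) := by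
  obtain ⟨C, hC, h⟩ := exists_dSq1_le
  refine ⟨C, hC, fun f hf => ?_⟩
  rw [dSq2_eq, dSq3_eq, sSq2_eq, ← Finset.sum_add_distrib, Finset.mul_sum]
  exact Finset.sum_le_sum fun i _ => h _ (contDiff_two_pd hf i)

lemma exists_sSq1_le : ∃ C : ℝ, 0 < C ∧ ∀ f : E5 → ℂ, ContDiff ℝ 2 f →
    sSq1 f ≤ C * (dSq1 f + dSq2 f) := by
  obtain ⟨C, hC, h⟩ := exists_sSq_le
  refine ⟨C, hC, fun f hf => ?_⟩
  rw [dSq2_eq, dSq1, sSq1, ← Finset.sum_add_distrib, Finset.mul_sum]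
  exact Finset.sum_le_sum fun i _ => h _ (contDiff_one_pd hf i)

lemma exists_sSq2_le : ∃ C : ℝ, 0 < C ∧ ∀ f : E5 → ℂ, ContDiff ℝ 3 f →
    sSq2 f ≤ C * (dSq2 f + dSq3 f) := by
  obtain ⟨C, hC, h⟩ := exists_sSq1_le
  refine ⟨C, hC, fun f hf => ?_⟩
  rw [dSq2_eq, dSq3_eq, sSq2_eq, ← Finset.sum_add_distrib, Finset.mul_sum]
  exact Finset.sum_le_sum fun i _ => h _ (contDiff_two_pd hf i)

lemma exists_HSq_le_energy : ∃ K : ℝ, 0 < K ∧ ∀ u : (E5 → ℂ) × (E5 → ℂ),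
    ContDiff ℝ 3 u.1 → ContDiff ℝ 2 u.2 → HSq 3 u.1 + HSq 2 u.2 ≤ K * energy u := by
  obtain ⟨A, hA, hA'⟩ := exists_bL2Sq_le
  obtain ⟨B, hB, hB'⟩ := exists_bL2Sq_le_sSq
  obtain ⟨P, hP, hP'⟩ := exists_dSq1_le
  obtain ⟨R, hR, hR'⟩ := exists_dSq2_le
  have hM := surf_real_univ_pos
  set M := surf.real univ
  refine ⟨1024 * (A * (P * (R + 1) + (2 + 1000 * M)) + P * (R + 1) + R + 1) +
    243 * (B * (P + 1) + P + 1), by positivity, fun u h1 h2 => ?_⟩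
  set X := energy u with hX
  have e0 := dSq3_nonneg u.1
  have e1 := dSq2_nonneg u.2
  have e2 := sSq2_nonneg u.1
  have e3 := sSq1_nonneg u.1
  have e4 := sSq1_nonneg u.2
  have e5 := sSq_nonneg u.2
  have e6 := dSq1_nonneg (lap u.1)
  have e7 := sq_nonneg ‖∫ ω, zeta u ω ∂surf‖
  have hXd : X = 7 * (dSq3 u.1 + dSq2 u.2 + sSq2 u.1) +
    3 * (dSq1 (lap u.1) + dSq2 u.2 + sSq1 u.2) +
    sSq u.2 + sSq1 u.1 + ‖∫ ω, zeta u ω ∂surf‖ ^ 2 := rfl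
  have b1 : dSq2 u.1 ≤ R * X := (hR' _ h1).trans (by gcongr; linarith)
  have b2 : dSq1 u.1 ≤ P * ((R + 1) * X) :=
    (hP' _ (h1.of_le (by norm_num))).trans (by gcongr; linarith)
  have b3 : ‖∫ ω, u.1 ω ∂surf‖ ^ 2 ≤ (2 + 1000 * M) * X := by
    have t := sq_norm_integral_zetaTail_le h1 h2
    have hz := integral_zeta h1 h2
    have hn : 3 * ‖∫ ω, u.1 ω ∂surf‖ ≤ ‖∫ ω, zeta u ω ∂surf‖ + ‖∫ ω, zetaTail u ω ∂surf‖ := by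
      have : (3 : ℂ) * (∫ ω, u.1 ω ∂surf) =
        (∫ ω, zeta u ω ∂surf) - ∫ ω, zetaTail u ω ∂surf := by rw [hz]; ring
      have h := norm_sub_le (∫ ω, zeta u ω ∂surf) (∫ ω, zetaTail u ω ∂surf)
      rw [← this, norm_mul] at h
      simpa using h
    have hsq := pow_le_pow_left₀ (by positivity) hn 2
    have ht : 500 * M * (sSq2 u.1 + sSq1 u.1 + sSq1 u.2 + sSq u.2) ≤ 500 * M * X := by
      gcongr
      linarith
    nlinarith [sq_nonneg (‖∫ ω, zeta u ω ∂surf‖ - ‖∫ ω, zetaTail u ω ∂surf‖),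
      sq_nonneg ‖∫ ω, u.1 ω ∂surf‖]
  have b4 : bL2Sq u.1 ≤ A * ((P * (R + 1) + (2 + 1000 * M)) * X) :=
    (hA' _ (h1.of_le (by norm_num))).trans (by gcongr; linarith)
  have b5 : dSq1 u.2 ≤ P * X := (hP' _ h2).trans (by gcongr; linarith)
  have b6 : bL2Sq u.2 ≤ B * ((P + 1) * X) :=
    (hB' _ (h2.of_le (by norm_num))).trans (by gcongr; linarith)
  have b7 := HSq_three_le u.1
  have b8 := HSq_two_le u.2
  have b9 : dSq3 u.1 ≤ X := by linarith
  have b10 : dSq2 u.2 ≤ X := by linarith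
  linarith

lemma exists_energy_le_HSq : ∃ K : ℝ, 0 < K ∧ ∀ u : (E5 → ℂ) × (E5 → ℂ),
    ContDiff ℝ 3 u.1 → ContDiff ℝ 2 u.2 → energy u ≤ K * (HSq 3 u.1 + HSq 2 u.2) := by
  obtain ⟨A, hA, hA'⟩ := exists_sSq_le
  obtain ⟨B, hB, hB'⟩ := exists_sSq1_le
  obtain ⟨P, hP, hP'⟩ := exists_sSq2_le
  have hM := surf_real_univ_pos
  set M := surf.real univ
  refine ⟨7 * (125 + 25 + P * 150) + 3 * (625 + 25 + B * 30) + A * 6 + B * 30 +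
    (18 * M * (A * 6) + 1000 * M * (P * 150 + B * 30 + B * 30 + A * 6)), by positivity,
    fun u h1 h2 => ?_⟩
  have n1 := HSq_nonneg 3 u.1
  have n2 := HSq_nonneg 2 u.2
  have h1' : ContDiff ℝ (3 : ℕ) u.1 := h1
  have h2' : ContDiff ℝ (2 : ℕ) u.2 := h2
  have c0 := bL2Sq_le_HSq h1'
  have c1 := dSq1_le_HSq h1' (by norm_num)
  have c2 := dSq2_le_HSq h1' (by norm_num)
  have c3 := dSq3_le_HSq h1' le_rfl
  have d0 := bL2Sq_le_HSq h2'
  have d1 := dSq1_le_HSq h2' (by norm_num)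
  have d2 := dSq2_le_HSq h2' le_rfl
  set H := HSq 3 u.1 + HSq 2 u.2 with hH
  have s0 : sSq u.1 ≤ A * (6 * H) :=
    (hA' _ (h1.of_le (by norm_num))).trans (by gcongr; linarith)
  have s1 : sSq1 u.1 ≤ B * (30 * H) :=
    (hB' _ (h1.of_le (by norm_num))).trans (by gcongr; linarith)
  have s2 : sSq2 u.1 ≤ P * (150 * H) := (hP' _ h1).trans (by gcongr; linarith)
  have t0 : sSq u.2 ≤ A * (6 * H) :=
    (hA' _ (h2.of_le (by norm_num))).trans (by gcongr; linarith)
  have t1 : sSq1 u.2 ≤ B * (30 * H) := (hB' _ h2).trans (by gcongr; linarith)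
  have hl := dSq1_lap_le h1
  have hz : ‖∫ ω, zeta u ω ∂surf‖ ^ 2 ≤
      18 * M * (A * (6 * H)) + 1000 * M * (P * (150 * H) + B * (30 * H) + B * (30 * H) +
        A * (6 * H)) := by
    have t := sq_norm_integral_zetaTail_le h1 h2
    have t' := sq_norm_surf_integral_le h1.continuous
    have hn : ‖∫ ω, zeta u ω ∂surf‖ ≤ 3 * ‖∫ ω, u.1 ω ∂surf‖ + ‖∫ ω, zetaTail u ω ∂surf‖ := by
      rw [integral_zeta h1 h2]
      refine (norm_add_le _ _).trans ?_
      simp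
    have hsq := pow_le_pow_left₀ (norm_nonneg _) hn 2
    have ht : 500 * M * (sSq2 u.1 + sSq1 u.1 + sSq1 u.2 + sSq u.2) ≤
        500 * M * (P * (150 * H) + B * (30 * H) + B * (30 * H) + A * (6 * H)) := by
      gcongr
    have ht' : M * sSq u.1 ≤ M * (A * (6 * H)) := by gcongr
    nlinarith [sq_nonneg (3 * ‖∫ ω, u.1 ω ∂surf‖ - ‖∫ ω, zetaTail u ω ∂surf‖)]
  rw [energy]
  linarith

lemma eqOn_zero_of_bL2Sq_eq_zero {f : E5 → ℂ} (hf : Continuous f) (h : bL2Sq f = 0) :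
    EqOn f 0 (closedBall 0 1) := by
  have hae : (fun x => ‖f x‖ ^ 2) =ᵐ[volume.restrict ball5] 0 :=
    (integral_eq_zero_iff_of_nonneg (fun x => sq_nonneg _)
      (hf.norm.pow 2).integrable_ball5).1 h
  have hae' : f =ᵐ[volume.restrict ball5] 0 := by
    filter_upwards [hae] with x hx
    simpa using hx
  have hb : EqOn f 0 ball5 :=
    Measure.eqOn_open_of_ae_eq hae' isOpen_ball hf.continuousOn continuousOn_const
  have := hb.closure hf continuous_const
  rwa [ball5, closure_ball _ one_ne_zero] at this

end

/-- Lemma 4.3 (Sobolevequiv): `(·|·)` is a hermitian, positive definite sesquilinear form on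
`C³(cl B⁵;ℂ) × C²(cl B⁵;ℂ)` and the induced norm is equivalent to the `H³(B⁵) × H²(B⁵)` norm. -/
theorem stmt_3 :
    -- hermitian
    (∀ u v : (E5 → ℂ) × (E5 → ℂ), ContDiff ℝ 3 u.1 → ContDiff ℝ 2 u.2 →
      ContDiff ℝ 3 v.1 → ContDiff ℝ 2 v.2 → ipT u v = conj (ipT v u)) ∧
    -- positive definite (as a form on functions on the closed ball)
    (∀ u : (E5 → ℂ) × (E5 → ℂ), ContDiff ℝ 3 u.1 → ContDiff ℝ 2 u.2 →
      (∃ x ∈ Metric.closedBall (0 : E5) 1, u.1 x ≠ 0 ∨ u.2 x ≠ 0) →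
      0 < (ipT u u).re) ∧
    -- the induced norm is equivalent to the `H³ × H²` norm
    (∃ c C : ℝ, 0 < c ∧ 0 < C ∧
      ∀ u : (E5 → ℂ) × (E5 → ℂ), ContDiff ℝ 3 u.1 → ContDiff ℝ 2 u.2 →
        c * (HSq 3 u.1 + HSq 2 u.2) ≤ (ipT u u).re ∧
          (ipT u u).re ≤ C * (HSq 3 u.1 + HSq 2 u.2)) := by
  obtain ⟨K, hK, hlow⟩ := exists_HSq_le_energy
  obtain ⟨C, hC, hupp⟩ := exists_energy_le_HSq
  refine ⟨fun u v _ _ _ _ => ipT_conj_symm u v, fun u h1 h2 => ?_,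
    K⁻¹, C, inv_pos.2 hK, hC, fun u h1 h2 => ?_⟩
  · rintro ⟨x, hx, hne⟩
    rw [ipT_self, Complex.ofReal_re]
    by_contra! hneg
    have hle := (hlow u h1 h2).trans (mul_nonpos_of_nonneg_of_nonpos hK.le hneg)
    have n1 := bL2Sq_le_HSq (m := 3) h1
    have n2 := bL2Sq_le_HSq (m := 2) h2
    have p1 := bL2Sq_nonneg u.1
    have p2 := bL2Sq_nonneg u.2
    rcases hne with hne | hne
    · exact hne (eqOn_zero_of_bL2Sq_eq_zero h1.continuous (by linarith) hx)
    · exact hne (eqOn_zero_of_bL2Sq_eq_zero h2.continuous (by linarith) hx)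
  · rw [ipT_self, Complex.ofReal_re]
    exact ⟨(inv_mul_le_iff₀ hK).2 (hlow u h1 h2), hupp u h1 h2⟩

end
end

section
/- For every F ∈ C^∞(cl B⁵; ℂ) and every ε > 0, there exists v ∈ C⁴(cl B⁵; ℂ) such that the function h defined by h(ξ) := −(δ^{ij} − ξ^iξ^j) ∂_i∂_j v(ξ) + 7 ξ^j ∂_j v(ξ) + (35/4) v(ξ) belongs to C²(cl B⁵; ℂ) and satisfies ‖h − F‖_{H²(B⁵)} < ε. -/
open MeasureTheory

noncomputable section

/-- the polynomial function on `ℝ⁵` attached to a complex polynomial in five variables -/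
def polyFun (p : MvPolynomial (Fin 5) ℂ) : E5 → ℂ :=
  fun x => MvPolynomial.eval (fun j => (x j : ℂ)) p

lemma contDiff_coord (i : Fin 5) {n : WithTop ℕ∞} : ContDiff ℝ n (fun x : E5 => (x i : ℂ)) :=
  Complex.ofRealCLM.contDiff.comp (EuclideanSpace.proj (𝕜 := ℝ) i).contDiff

lemma pd_coord (i j : Fin 5) (x : E5) :
    pd i (fun x : E5 => (x j : ℂ)) x = if j = i then 1 else 0 := by
  have h : HasFDerivAt (fun x : E5 => (x j : ℂ))
      (Complex.ofRealCLM.comp (EuclideanSpace.proj (𝕜 := ℝ) j)) x :=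
    (Complex.ofRealCLM.comp (EuclideanSpace.proj (𝕜 := ℝ) j)).hasFDerivAt
  rw [pd, h.fderiv]
  by_cases hij : j = i <;> simp [hij]

lemma polyFun_C (a : ℂ) : polyFun (MvPolynomial.C a) = fun _ => a := by
  ext; simp [polyFun]

lemma polyFun_add (p q : MvPolynomial (Fin 5) ℂ) : polyFun (p + q) = polyFun p + polyFun q := by
  ext; simp [polyFun]

lemma polyFun_mul_X (p : MvPolynomial (Fin 5) ℂ) (j : Fin 5) :
    polyFun (p * MvPolynomial.X j) = polyFun p * fun x : E5 => (x j : ℂ) := by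
  ext; simp [polyFun]

lemma contDiff_polyFun (p : MvPolynomial (Fin 5) ℂ) {n : WithTop ℕ∞} :
    ContDiff ℝ n (polyFun p) := by
  induction p using MvPolynomial.induction_on with
  | C a => rw [polyFun_C]; exact contDiff_const
  | add p q hp hq => rw [polyFun_add]; exact hp.add hq
  | mul_X p i hp => rw [polyFun_mul_X]; exact hp.mul (contDiff_coord i)

lemma pd_polyFun (i : Fin 5) (p : MvPolynomial (Fin 5) ℂ) :
    pd i (polyFun p) = polyFun (MvPolynomial.pderiv i p) := by
  have hd (p) (x : E5) : DifferentiableAt ℝ (polyFun p) x :=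
    (contDiff_polyFun p (n := 1)).differentiable one_ne_zero x
  induction p using MvPolynomial.induction_on with
  | C a => ext x; simp [pd, polyFun_C, polyFun]
  | add p q hp hq =>
    ext x
    rw [polyFun_add, pd, fderiv_add (hd p x) (hd q x), add_apply]
    change pd i (polyFun p) x + pd i (polyFun q) x = _
    rw [hp, hq]
    simp [polyFun]
  | mul_X p j hp =>
    ext x
    have hj : DifferentiableAt ℝ (fun x : E5 => (x j : ℂ)) x :=
      (contDiff_coord j (n := 1)).differentiable one_ne_zero x
    rw [polyFun_mul_X, pd, fderiv_mul (hd p x) hj]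
    change polyFun p x * pd i (fun x : E5 => (x j : ℂ)) x + (x j : ℂ) * pd i (polyFun p) x = _
    rw [hp, pd_coord]
    by_cases hij : j = i
    · subst hij; simp [polyFun]
    · simp [polyFun, MvPolynomial.pderiv_X_of_ne hij, hij]

open MvPolynomial in
/-- the operator `-(δ^{ij} - ξ^iξ^j)∂_i∂_j + 7ξ^j∂_j + 35/4` on polynomials -/
def polyOp (p : MvPolynomial (Fin 5) ℂ) : MvPolynomial (Fin 5) ℂ :=
  -(∑ i, ∑ j, ((if i = j then 1 else 0) - X i * X j) * pderiv i (pderiv j p)) +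
    7 * (∑ j, X j * pderiv j p) + C (35 / 4) * p

lemma polyOp_add (p q : MvPolynomial (Fin 5) ℂ) : polyOp (p + q) = polyOp p + polyOp q := by
  simp only [polyOp, map_add, mul_add, Finset.sum_add_distrib]
  ring

lemma polyOp_C_mul (a : ℂ) (p : MvPolynomial (Fin 5) ℂ) :
    polyOp (MvPolynomial.C a * p) = MvPolynomial.C a * polyOp p := by
  simp only [polyOp, ← MvPolynomial.smul_eq_C_mul, Derivation.map_smul, mul_smul_comm, ← Finset.smul_sum,
    smul_add, smul_neg]

lemma polyOp_of_isHomogeneous {n : ℕ} {p : MvPolynomial (Fin 5) ℂ} (hp : p.IsHomogeneous n) :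
    polyOp p = MvPolynomial.C ((n : ℂ) ^ 2 + 6 * n + 35 / 4) * p -
      ∑ j, MvPolynomial.pderiv j (MvPolynomial.pderiv j p) := by
  have h2 : ∑ i, ∑ j, (MvPolynomial.X i * MvPolynomial.X j) *
      MvPolynomial.pderiv i (MvPolynomial.pderiv j p) = ((n - 1) * n : ℕ) • p := by
    rw [Finset.sum_comm, mul_nsmul', ← hp.sum_X_mul_pderiv, Finset.smul_sum]
    refine Finset.sum_congr rfl fun j _ => ?_
    rw [← mul_smul_comm, ← (hp.pderiv (i := j)).sum_X_mul_pderiv, Finset.mul_sum]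
    exact Finset.sum_congr rfl fun i _ => by ring
  have h3 : (((n - 1) * n : ℕ) : ℂ) = (n : ℂ) ^ 2 - n := by
    cases n <;> simp; ring
  simp only [polyOp, sub_mul, Finset.sum_sub_distrib, h2, hp.sum_X_mul_pderiv, ite_mul, one_mul,
    zero_mul, Finset.sum_ite_eq, Finset.mem_univ, if_true, nsmul_eq_mul]
  rw [← map_natCast (MvPolynomial.C (σ := Fin 5) (R := ℂ)) ((n - 1) * n), h3]
  simp only [map_add, map_sub, map_mul, map_pow, map_natCast, map_ofNat]
  ring

lemma exists_polyOp_eq_of_isHomogeneous (n : ℕ) :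
    ∀ p : MvPolynomial (Fin 5) ℂ, p.IsHomogeneous n → ∃ q, polyOp q = p := by
  induction n using Nat.strong_induction_on with
  | _ n ih =>
    intro p hp
    have hlap : ∃ q, polyOp q = ∑ j, MvPolynomial.pderiv j (MvPolynomial.pderiv j p) := by
      rcases Nat.eq_zero_or_pos n with rfl | hn
      · rw [← MvPolynomial.totalDegree_zero_iff_isHomogeneous,
          MvPolynomial.totalDegree_eq_zero_iff_eq_C] at hp
        refine ⟨0, ?_⟩
        rw [hp]
        simp [polyOp]
      · exact ih (n - 1 - 1) (by omega) _
          (MvPolynomial.IsHomogeneous.sum _ _ _ fun j _ => hp.pderiv.pderiv)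
    obtain ⟨q, hq⟩ := hlap
    have hc : (n : ℂ) ^ 2 + 6 * n + 35 / 4 ≠ 0 := by
      have : ((n : ℝ) ^ 2 + 6 * n + 35 / 4) ≠ 0 := by positivity
      simpa using Complex.ofReal_ne_zero.2 this
    refine ⟨MvPolynomial.C ((n : ℂ) ^ 2 + 6 * n + 35 / 4)⁻¹ * (p + q), ?_⟩
    rw [polyOp_C_mul, polyOp_add, hq, polyOp_of_isHomogeneous hp, sub_add_cancel, ← mul_assoc,
      ← MvPolynomial.C_mul, inv_mul_cancel₀ hc, MvPolynomial.C_1, one_mul]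

lemma polyOp_surjective : Function.Surjective polyOp := by
  intro p
  have hz : polyOp 0 = 0 := by simp [polyOp]
  choose q hq using fun n => exists_polyOp_eq_of_isHomogeneous n _
    (MvPolynomial.homogeneousComponent_isHomogeneous n p)
  refine ⟨∑ n ∈ Finset.range (p.totalDegree + 1), q n, ?_⟩
  let φ : MvPolynomial (Fin 5) ℂ →+ MvPolynomial (Fin 5) ℂ := ⟨⟨polyOp, hz⟩, polyOp_add⟩
  calc φ (∑ n ∈ Finset.range (p.totalDegree + 1), q n) = _ := map_sum φ _ _
    _ = _ := Finset.sum_congr rfl fun n _ => hq n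
    _ = p := MvPolynomial.sum_homogeneousComponent p

lemma polyFun_polyOp (p : MvPolynomial (Fin 5) ℂ) (ξ : E5) :
    -(∑ i : Fin 5, ∑ j : Fin 5,
        ((if i = j then (1 : ℂ) else 0) - (ξ i : ℂ) * (ξ j : ℂ)) * pd i (pd j (polyFun p)) ξ) +
      7 * (∑ j : Fin 5, (ξ j : ℂ) * pd j (polyFun p) ξ) + (35 / 4) * polyFun p ξ =
    polyFun (polyOp p) ξ := by
  simp only [pd_polyFun, polyOp, polyFun, map_add, map_neg, map_sum, map_mul, map_sub,
    MvPolynomial.eval_X, MvPolynomial.eval_C, apply_ite (MvPolynomial.eval _), map_one, map_zero,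
    map_ofNat]

/-- the unnormalised Landau kernel of radius `3` -/
def landau (n : ℕ) (y : E5) : ℝ := (1 - ‖y‖ ^ 2 / 9) ^ n

open scoped Convolution in
/-- the convolution of a function with the normalised Landau kernel of radius `3` -/
def mollify (n : ℕ) (g : E5 → ℂ) : E5 → ℂ := fun x =>
  (∫ y in Metric.closedBall (0 : E5) 3, landau n y)⁻¹ •
    (landau n ⋆[ContinuousLinearMap.lsmul ℝ ℝ, volume] g) x

/-- smooth functions supported in the closed ball of radius `2` -/
def IsTest (g : E5 → ℂ) : Prop :=
  ContDiff ℝ (⊤ : ℕ∞) g ∧ tsupport g ⊆ Metric.closedBall 0 2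

lemma continuous_landau (n : ℕ) : Continuous (landau n) := by
  unfold landau; fun_prop

lemma landau_nonneg (n : ℕ) {y : E5} (hy : y ∈ Metric.closedBall (0 : E5) 3) :
    0 ≤ landau n y := by
  rw [mem_closedBall_zero_iff] at hy
  exact pow_nonneg (by nlinarith [norm_nonneg y]) n

namespace IsTest

variable {g : E5 → ℂ}

lemma hasCompactSupport (hg : IsTest g) : HasCompactSupport g :=
  (isCompact_closedBall (0 : E5) 2).of_isClosed_subset (isClosed_tsupport g) hg.2

lemma continuous (hg : IsTest g) : Continuous g := hg.1.continuous

lemma differentiable (hg : IsTest g) : Differentiable ℝ g := hg.1.differentiable (by simp)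

lemma pd (hg : IsTest g) (i : Fin 5) : IsTest (pd i g) :=
  ⟨(hg.1.fderiv_right (m := (⊤ : ℕ∞)) (by simp)).clm_apply contDiff_const,
    (tsupport_fderiv_apply_subset ℝ _).trans hg.2⟩

lemma hasFDerivAt_mollify (hg : IsTest g) (n : ℕ) (x : E5) :
    HasFDerivAt (mollify n g) ((∫ y in Metric.closedBall (0 : E5) 3, landau n y)⁻¹ •
      (MeasureTheory.convolution (landau n) (fderiv ℝ g)
        ((ContinuousLinearMap.lsmul ℝ ℝ).precompR E5) volume) x) x := by
  have h := hg.hasCompactSupport.hasFDerivAt_convolution_right (μ := volume)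
    (ContinuousLinearMap.lsmul ℝ ℝ) (continuous_landau n).locallyIntegrable
    (hg.1.of_le (by simp)) x
  exact h.const_smul (∫ y in Metric.closedBall (0 : E5) 3, landau n y)⁻¹

lemma pd_mollify (hg : IsTest g) (n : ℕ) (i : Fin 5) :
    _root_.pd i (mollify n g) = mollify n (_root_.pd i g) := by
  ext x
  rw [_root_.pd, (hg.hasFDerivAt_mollify n x).fderiv, smul_apply,
    convolution_precompR_apply _ (continuous_landau n).locallyIntegrable
      (hg.hasCompactSupport.fderiv ℝ) (hg.1.continuous_fderiv (by simp))]
  rfl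

lemma pd_mollify_sub (hg : IsTest g) (n : ℕ) (i : Fin 5) :
    _root_.pd i (mollify n g - g) = mollify n (_root_.pd i g) - _root_.pd i g := by
  rw [← hg.pd_mollify n i]
  ext x
  rw [_root_.pd, fderiv_sub (hg.hasFDerivAt_mollify n x).differentiableAt (hg.differentiable x)]
  rfl

lemma iterate_pd (hg : IsTest g) (n : ℕ) (i : Fin 5) (k : ℕ) :
    IsTest ((_root_.pd i)^[k] g) ∧ (_root_.pd i)^[k] (mollify n g - g) =
      mollify n ((_root_.pd i)^[k] g) - (_root_.pd i)^[k] g := by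
  induction k with
  | zero => exact ⟨hg, rfl⟩
  | succ k ih =>
    simp only [Function.iterate_succ_apply']
    exact ⟨ih.1.pd i, by rw [ih.2, ih.1.pd_mollify_sub]⟩

lemma pdM (hg : IsTest g) (n : ℕ) (β : Fin 5 → ℕ) :
    IsTest (pdM β g) ∧ _root_.pdM β (mollify n g - g) =
      mollify n (_root_.pdM β g) - _root_.pdM β g := by
  unfold _root_.pdM
  induction List.finRange 5 with
  | nil => exact ⟨hg, rfl⟩
  | cons i l ih =>
    simp only [List.foldr_cons]
    rw [ih.2]
    exact ih.1.iterate_pd n i (β i)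

lemma mollify_eq_setIntegral (hg : IsTest g) (n : ℕ) {x : E5} (hx : x ∈ ball5) :
    mollify n g x = (∫ y in Metric.closedBall (0 : E5) 3, landau n y)⁻¹ •
      ∫ y in Metric.closedBall (0 : E5) 3, landau n y • g (x - y) := by
  rw [mollify, convolution_def,
    setIntegral_eq_integral_of_forall_compl_eq_zero (f := fun y => landau n y • g (x - y))]
  · rfl
  · intro y hy
    have : x - y ∉ tsupport g := fun h => hy <| by
      have h2 := hg.2 h
      rw [ball5, mem_ball_zero_iff] at hx
      rw [mem_closedBall_zero_iff] at h2 ⊢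
      calc ‖y‖ = ‖x - (x - y)‖ := by rw [sub_sub_cancel]
        _ ≤ ‖x‖ + ‖x - y‖ := norm_sub_le _ _
        _ ≤ 3 := by linarith
    rw [image_eq_zero_of_notMem_tsupport this, smul_zero]

lemma norm_mollify_le (hg : IsTest g) (n : ℕ) {M : ℝ} (hM : ∀ x, ‖g x‖ ≤ M) {x : E5}
    (hx : x ∈ ball5) : ‖mollify n g x‖ ≤ M := by
  rw [hg.mollify_eq_setIntegral n hx, norm_smul]
  set I := ∫ y in Metric.closedBall (0 : E5) 3, landau n y with hI
  have hI0 : 0 ≤ I := setIntegral_nonneg measurableSet_closedBall fun y hy => landau_nonneg n hy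
  have hM0 : 0 ≤ M := (norm_nonneg _).trans (hM 0)
  have hint : IntegrableOn (landau n) (Metric.closedBall (0 : E5) 3) :=
    (continuous_landau n).continuousOn.integrableOn_compact (isCompact_closedBall _ _)
  have hle : ‖∫ y in Metric.closedBall (0 : E5) 3, landau n y • g (x - y)‖ ≤ I * M := by
    rw [hI, ← integral_mul_const]
    refine norm_integral_le_of_norm_le (hint.mul_const M) ?_
    filter_upwards [ae_restrict_mem measurableSet_closedBall] with y hy
    rw [norm_smul, Real.norm_of_nonneg (landau_nonneg n hy)]
    exact mul_le_mul_of_nonneg_left (hM _) (landau_nonneg n hy)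
  rw [norm_inv, Real.norm_of_nonneg hI0]
  rcases hI0.eq_or_lt with h | h
  · rw [← h]; simpa using hM0
  · rw [inv_mul_le_iff₀ h]; exact hle

lemma tendsto_mollify (hg : IsTest g) {x : E5} (hx : x ∈ ball5) :
    Filter.Tendsto (fun n => mollify n g x) Filter.atTop (nhds (g x)) := by
  simp_rw [fun n => hg.mollify_eq_setIntegral n hx]
  have key := tendsto_setIntegral_pow_smul_of_unique_maximum_of_isCompact_of_continuousOn
    (μ := volume) (s := Metric.closedBall (0 : E5) 3) (x₀ := 0) (c := fun y => 1 - ‖y‖ ^ 2 / 9)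
    (g := fun y => g (x - y)) (isCompact_closedBall _ _) (by fun_prop)
    (fun y _ hy => by have := norm_pos_iff.2 hy; simp; positivity)
    (fun y hy => by simpa [landau] using landau_nonneg 1 hy) (by simp)
    (by
      rw [interior_closedBall _ (by norm_num)]
      exact subset_closure (Metric.mem_ball_self (by norm_num)))
    (hg.continuous.comp (by fun_prop)).continuousOn
  simpa [landau] using key

lemma tendsto_bL2Sq_mollify_sub (hg : IsTest g) :
    Filter.Tendsto (fun n => bL2Sq (mollify n g - g)) Filter.atTop (nhds 0) := by
  obtain ⟨M, hM⟩ := hg.hasCompactSupport.exists_bound_of_continuous hg.continuous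
  have hfin : IsFiniteMeasure (volume.restrict ball5) :=
    ⟨by rw [Measure.restrict_apply_univ]; exact Metric.isBounded_ball.measure_lt_top⟩
  have hcont (n : ℕ) : Continuous (mollify n g) :=
    continuous_iff_continuousAt.2 fun x => (hg.hasFDerivAt_mollify n x).continuousAt
  have key := tendsto_integral_of_dominated_convergence (μ := volume.restrict ball5)
    (F := fun n x => ‖(mollify n g - g) x‖ ^ 2) (f := fun _ => 0) (fun _ => (M + M) ^ 2)
    (fun n => (((hcont n).sub hg.continuous).norm.pow 2).aestronglyMeasurable)
    (integrable_const _) ?_ ?_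
  · simpa [bL2Sq] using key
  · intro n
    filter_upwards [ae_restrict_mem Metric.isOpen_ball.measurableSet] with x hx
    rw [norm_pow, norm_norm]
    gcongr
    exact (norm_sub_le _ _).trans (add_le_add (hg.norm_mollify_le n hM hx) (hM x))
  · filter_upwards [ae_restrict_mem Metric.isOpen_ball.measurableSet] with x hx
    have := (((hg.tendsto_mollify hx).sub_const (g x)).norm).pow 2
    simpa using this

end IsTest

/-- integrating a polynomial with continuous coefficients against a compactly supported function
yields a polynomial -/
lemma exists_polyFun_eq_integral (Q : MvPolynomial (Fin 5) C(E5, ℂ)) {g : E5 → ℂ}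
    (hg : Continuous g) (hgc : HasCompactSupport g) :
    ∃ p, ∀ x : E5, polyFun p x = ∫ t, MvPolynomial.eval₂
      (ContinuousMap.evalAlgHom ℂ ℂ t : C(E5, ℂ) →+* ℂ) (fun i => (x i : ℂ)) Q * g t := by
  refine ⟨∑ d ∈ Q.support, MvPolynomial.monomial d (∫ t, Q.coeff d t * g t), fun x => ?_⟩
  simp only [MvPolynomial.eval₂_eq', Finset.sum_mul, polyFun, map_sum, MvPolynomial.eval_monomial]
  rw [integral_finsetSum]
  · refine Finset.sum_congr rfl fun d _ => ?_
    rw [← integral_mul_const]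
    refine integral_congr_ae (Filter.Eventually.of_forall fun t => ?_)
    simp [Finsupp.prod_fintype]
    ring
  · intro d _
    refine Continuous.integrable_of_hasCompactSupport ?_ hgc.mul_left
    exact (((Q.coeff d).continuous.mul continuous_const).mul hg)

lemma exists_polyFun_eq_mollify {g : E5 → ℂ} (hg : IsTest g) (n : ℕ) :
    ∃ p, polyFun p = mollify n g := by
  let coord (i : Fin 5) : C(E5, ℂ) := ⟨fun t => (t i : ℂ), by fun_prop⟩
  obtain ⟨p, hp⟩ := exists_polyFun_eq_integral
    ((1 - MvPolynomial.C (ContinuousMap.const E5 (1 / 9 : ℂ)) *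
      ∑ i, (MvPolynomial.X i - MvPolynomial.C (coord i)) ^ 2) ^ n)
    hg.continuous hg.hasCompactSupport
  refine ⟨MvPolynomial.C (((∫ y in Metric.closedBall (0 : E5) 3, landau n y)⁻¹ : ℝ) : ℂ) * p, ?_⟩
  ext x
  have h1 : polyFun (MvPolynomial.C
      (((∫ y in Metric.closedBall (0 : E5) 3, landau n y)⁻¹ : ℝ) : ℂ) * p) x =
      (((∫ y in Metric.closedBall (0 : E5) 3, landau n y)⁻¹ : ℝ) : ℂ) * polyFun p x := by
    simp [polyFun]
  rw [h1, hp, mollify, convolution_eq_swap, Complex.real_smul]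
  congr 1
  refine integral_congr_ae (Filter.Eventually.of_forall fun t => ?_)
  simp only [MvPolynomial.eval₂_pow, MvPolynomial.eval₂_sub, MvPolynomial.eval₂_mul,
    MvPolynomial.eval₂_one, MvPolynomial.eval₂_sum, MvPolynomial.eval₂_X, MvPolynomial.eval₂_C,
    ContinuousLinearMap.lsmul_apply, landau, EuclideanSpace.norm_sq_eq, Complex.real_smul]
  simp [coord, div_eq_inv_mul]

lemma Filter.EventuallyEq.pd {f g : E5 → ℂ} {x : E5} (h : f =ᶠ[nhds x] g) (i : Fin 5) :
    pd i f =ᶠ[nhds x] pd i g :=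
  h.fderiv.mono fun y hy => by rw [_root_.pd, _root_.pd, hy]

lemma Filter.EventuallyEq.pdM {f g : E5 → ℂ} {x : E5} (h : f =ᶠ[nhds x] g) (β : Fin 5 → ℕ) :
    pdM β f =ᶠ[nhds x] pdM β g := by
  unfold _root_.pdM
  induction List.finRange 5 with
  | nil => exact h
  | cons i l ih =>
    simp only [List.foldr_cons]
    induction β i with
    | zero => exact ih
    | succ k ihk => simpa only [Function.iterate_succ_apply'] using ihk.pd i

lemma HSq_congr (m : ℕ) {f g : E5 → ℂ} (h : Set.EqOn f g ball5) : HSq m f = HSq m g := by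
  refine Finset.sum_congr rfl fun β _ => ?_
  congr 1
  refine setIntegral_congr_fun Metric.isOpen_ball.measurableSet fun x hx => ?_
  have hfg : f =ᶠ[nhds x] g := h.eventuallyEq_of_mem (Metric.isOpen_ball.mem_nhds hx)
  simp only [(hfg.pdM fun i => (β i : ℕ)).eq_of_nhds]

lemma IsTest.tendsto_HSq_mollify_sub {g : E5 → ℂ} (hg : IsTest g) (m : ℕ) :
    Filter.Tendsto (fun n => HSq m (mollify n g - g)) Filter.atTop (nhds 0) := by
  rw [← Finset.sum_const_zero (s := (Finset.univ : Finset (Fin 5 → Fin (m + 1))))]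
  refine tendsto_finsetSum _ fun β _ => ?_
  split_ifs
  · simp_rw [fun n => (hg.pdM n fun i => (β i : ℕ)).2]
    exact (hg.pdM 0 fun i => (β i : ℕ)).1.tendsto_bL2Sq_mollify_sub
  · exact tendsto_const_nhds

lemma exists_isTest_eqOn {F : E5 → ℂ} (hF : ContDiff ℝ (⊤ : ℕ∞) F) :
    ∃ g, IsTest g ∧ Set.EqOn g F ball5 := by
  let χ : ContDiffBump (0 : E5) := ⟨1, 2, one_pos, one_lt_two⟩
  refine ⟨fun x => χ x • F x, ⟨χ.contDiff.smul hF, ?_⟩, fun x hx => ?_⟩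
  · exact (tsupport_smul_subset_left _ _).trans χ.tsupport_eq.subset
  · simp only
    rw [χ.one_of_mem_closedBall (Metric.ball_subset_closedBall hx), one_smul]

/-- polynomials are dense in `H^m(B⁵)` among smooth functions -/
lemma exists_HSq_polyFun_sub_lt {F : E5 → ℂ} (hF : ContDiff ℝ (⊤ : ℕ∞) F) (m : ℕ) {ε : ℝ}
    (hε : 0 < ε) : ∃ p, HSq m (fun x => polyFun p x - F x) < ε := by
  obtain ⟨g, hg, hgF⟩ := exists_isTest_eqOn hF
  obtain ⟨n, hn⟩ := ((hg.tendsto_HSq_mollify_sub m).eventually_lt_const hε).exists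
  obtain ⟨p, hp⟩ := exists_polyFun_eq_mollify hg n
  refine ⟨p, lt_of_eq_of_lt (HSq_congr m fun x hx => ?_) hn⟩
  rw [hp, Pi.sub_apply, hgF hx]

/-- Lemma 4.7 (technical): for every smooth `F` and `ε > 0` there is `v ∈ C⁴(cl B⁵)` such that
`h(ξ) = −(δ^{ij} − ξ^iξ^j)∂_i∂_j v(ξ) + 7ξ^j∂_j v(ξ) + (35/4)v(ξ)` is `C²` and
`‖h − F‖_{H²(B⁵)} < ε`. -/
theorem stmt_8 (F : E5 → ℂ) (hF : ContDiff ℝ (⊤ : ℕ∞) F) (ε : ℝ) (hε : 0 < ε) :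
    ∃ v : E5 → ℂ, ContDiff ℝ 4 v ∧
      ContDiff ℝ 2 (fun ξ : E5 =>
        -(∑ i : Fin 5, ∑ j : Fin 5,
            ((if i = j then (1 : ℂ) else 0) - (ξ i : ℂ) * (ξ j : ℂ)) * pd i (pd j v) ξ) +
          7 * (∑ j : Fin 5, (ξ j : ℂ) * pd j v ξ) + (35 / 4) * v ξ) ∧
      Real.sqrt (HSq 2 (fun ξ : E5 =>
        (-(∑ i : Fin 5, ∑ j : Fin 5,
            ((if i = j then (1 : ℂ) else 0) - (ξ i : ℂ) * (ξ j : ℂ)) * pd i (pd j v) ξ) +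
          7 * (∑ j : Fin 5, (ξ j : ℂ) * pd j v ξ) + (35 / 4) * v ξ) - F ξ)) < ε := by
  obtain ⟨p, hp⟩ := exists_HSq_polyFun_sub_lt hF 2 (pow_pos hε 2)
  obtain ⟨q, rfl⟩ := polyOp_surjective p
  refine ⟨polyFun q, contDiff_polyFun q, ?_, ?_⟩
  · simp only [polyFun_polyOp]
    exact contDiff_polyFun _
  · simp only [polyFun_polyOp]
    rwa [Real.sqrt_lt' hε]

end
end
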